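/- arXiv:2404.06445 — 2 statements merged into one kernel-verified Lean document; each statement's English description precedes it below -/
import Mathlib

section
/- Let G be a minimal bipartite matching covered graph that is not isomorphic to the cycle graph on 4 vertices. Then G contains an induced matching F such that every edge of F is a 2-edge of G and |F| ≥ m − n + 2 (equivalently, |F| + n ≥ m + 2), where n is the number of vertices and m the number of edges of G. -/
open SimpleGraph

/-- The degree of a vertex `v` in a graph `G`: the number of neighbours of `v`. -/
noncomputable def degN {V : Type*} (G : SimpleGraph V) (v : V) : ℕ :=
  (G.neighborSet v).ncard

/-- A finite simple graph is matching covered if it is connected, has at least 4 vertices,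
and every edge lies in some perfect matching. -/
def MatchingCovered {V : Type*} [Fintype V] (G : SimpleGraph V) : Prop :=
  G.Connected ∧ 4 ≤ Fintype.card V ∧
    ∀ e ∈ G.edgeSet, ∃ M : G.Subgraph, M.IsPerfectMatching ∧ e ∈ M.edgeSet

/-- A matching covered graph is minimal if deleting any edge destroys the property. -/
def MinimalMatchingCovered {V : Type*} [Fintype V] (G : SimpleGraph V) : Prop :=
  MatchingCovered G ∧ ∀ e ∈ G.edgeSet, ¬ MatchingCovered (G.deleteEdges {e})

/-- A 2-edge of `G`: an edge both of whose endpoints have degree exactly 2. -/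
def IsTwoEdge {V : Type*} (G : SimpleGraph V) (e : Sym2 V) : Prop :=
  e ∈ G.edgeSet ∧ ∀ v ∈ e, degN G v = 2

/-- An induced matching: a set of edges of `G`, no two of which share an endpoint, and such that
no edge of `G` joins an endpoint of one member to an endpoint of a different member. -/
def IsInducedMatching {V : Type*} (G : SimpleGraph V) (F : Set (Sym2 V)) : Prop :=
  F ⊆ G.edgeSet ∧
    ∀ e₁ ∈ F, ∀ e₂ ∈ F, e₁ ≠ e₂ → ∀ u ∈ e₁, ∀ v ∈ e₂, u ≠ v ∧ ¬ G.Adj u v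

theorem exists_facets {α : Type*} [Finite α] (L : Submodule ℝ (α → ℝ)) (E : Set α)
    (hE : ∀ x ∈ L, ∀ a ∉ E, x a = 0) (x₀ : α → ℝ) (hx₀ : x₀ ∈ L) (hpos : ∀ a ∈ E, 0 < x₀ a) :
    ∃ I : Finset α, (∀ e ∈ I, e ∈ E) ∧ Module.finrank ℝ L ≤ I.card ∧
      ∀ e ∈ I, ∃ z ∈ L, (∀ a, 0 ≤ z a) ∧ z e = 0 ∧ (∀ e' ∈ I, e' ≠ e → 0 < z e') ∧
        ∀ f ∈ E, z f = 0 → ∃ k > 0, ∀ x ∈ L, x f = k * x e := by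
  classical
  have := Fintype.ofFinite α
  let C : Finset α → Prop := fun I =>
    (∀ e ∈ I, e ∈ E) ∧ ∀ x ∈ L, (∀ e ∈ I, 0 ≤ x e) → ∀ a, 0 ≤ x a
  have hC : C (Finset.univ.filter (· ∈ E)) := by
    refine ⟨by simp, fun x hx h a => ?_⟩
    by_cases ha : a ∈ E
    · exact h a (by simpa using ha)
    · rw [hE x hx a ha]
  obtain ⟨I, ⟨hIE, hI⟩, hmin⟩ := (wellFounded_lt (α := Finset α)).has_min {I | C I} ⟨_, hC⟩
  refine ⟨I, hIE, ?_, fun e he => ?_⟩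
  · have hinj : Function.Injective
        ((LinearMap.pi fun i : I => LinearMap.proj (R := ℝ) (φ := fun _ : α => ℝ) i.1) ∘ₗ
          L.subtype) := by
      rw [← LinearMap.ker_eq_bot, LinearMap.ker_eq_bot']
      rintro ⟨x, hx⟩ h0
      have h1 : ∀ e ∈ I, x e = 0 := fun e he => congrFun h0 ⟨e, he⟩
      have h2 := hI x hx fun e he => (h1 e he).ge
      have h3 := hI (-x) (L.neg_mem hx) fun e he => by simp [h1 e he]
      ext a
      have := h3 a
      simp only [Pi.neg_apply] at this
      exact le_antisymm (show x a ≤ 0 by linarith) (h2 a)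
    simpa using LinearMap.finrank_le_finrank_of_injective hinj
  · have hex : ∃ y ∈ L, (∀ f ∈ I, f ≠ e → 0 ≤ y f) ∧ y e < 0 := by
      by_contra! hcon
      refine hmin (I.erase e) ⟨fun f hf => hIE f (Finset.mem_of_mem_erase hf),
        fun x hx h => ?_⟩ (Finset.erase_ssubset he)
      have h' : ∀ f ∈ I, f ≠ e → 0 ≤ x f := fun f hf hne => h f (Finset.mem_erase.2 ⟨hne, hf⟩)
      refine hI x hx fun f hf => ?_
      by_cases hfe : f = e
      · exact hfe ▸ hcon x hx h'
      · exact h' f hf hfe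
    obtain ⟨y, hy, hyI, hye⟩ := hex
    have hxe := hpos e (hIE e he)
    set z : α → ℝ := (-y e) • x₀ + x₀ e • y with hz
    have hzL : z ∈ L := L.add_mem (L.smul_mem _ hx₀) (L.smul_mem _ hy)
    have hze : z e = 0 := by simp [hz]; ring
    have hzI : ∀ f ∈ I, f ≠ e → 0 < z f := fun f hf hne => by
      have h1 := hyI f hf hne
      have h2 := hpos f (hIE f hf)
      simp only [hz, Pi.add_apply, Pi.smul_apply, smul_eq_mul]
      have : 0 < -y e * x₀ f := mul_pos (by linarith) h2
      have : 0 ≤ x₀ e * y f := by positivity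
      linarith
    have hzI' : ∀ f ∈ I, 0 ≤ z f := fun f hf => by
      by_cases hfe : f = e
      · rw [hfe, hze]
      · exact (hzI f hf hfe).le
    refine ⟨z, hzL, hI z hzL hzI', hze, hzI, fun f hf hzf =>
      ⟨x₀ f / x₀ e, div_pos (hpos f hf) hxe, ?_⟩⟩
    have key : ∀ w ∈ L, w e = 0 → 0 ≤ w f := by
      intro w hw hwe
      set N : ℝ := ∑ g ∈ I.erase e, |w g| / z g with hN
      have hN0 : 0 ≤ N := Finset.sum_nonneg fun g hg =>
        div_nonneg (abs_nonneg _) (hzI' g (Finset.mem_of_mem_erase hg))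
      have := hI (N • z + w) (L.add_mem (L.smul_mem _ hzL) hw) (fun g hg => by
        by_cases hge : g = e
        · simp [hge, hze, hwe]
        · have h1 := hzI g hg hge
          have h2 : |w g| / z g ≤ N := Finset.single_le_sum (f := fun g => |w g| / z g)
            (fun g hg => div_nonneg (abs_nonneg _) (hzI' g (Finset.mem_of_mem_erase hg)))
            (Finset.mem_erase.2 ⟨hge, hg⟩)
          rw [div_le_iff₀ h1] at h2
          have := neg_abs_le (w g)
          simp only [Pi.add_apply, Pi.smul_apply, smul_eq_mul]
          linarith) f
      simpa [hzf] using this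
    intro x hx
    have hw : x - (x e / x₀ e) • x₀ ∈ L := L.sub_mem hx (L.smul_mem _ hx₀)
    have hwe : (x - (x e / x₀ e) • x₀) e = 0 := by simp [hxe.ne']
    have h1 := key _ hw hwe
    have h2 := key _ (L.neg_mem hw) (by simp only [Pi.neg_apply, hwe, neg_zero])
    simp only [Pi.sub_apply, Pi.smul_apply, smul_eq_mul, Pi.neg_apply] at h1 h2
    have h3 : x f = x e / x₀ e * x₀ f := by linarith
    rw [h3]; ring

section Weights

variable {V : Type*}

/-- The sign `±1` of a colour class. -/
def sgn (c : V → Bool) (u : V) : ℝ := if c u then 1 else -1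

theorem sgn_ne_zero (c : V → Bool) (u : V) : sgn c u ≠ 0 := by
  unfold sgn; split_ifs <;> norm_num

theorem sgn_eq_neg {c : V → Bool} {u v : V} (h : c u ≠ c v) : sgn c u = -sgn c v := by
  unfold sgn
  cases hu : c u <;> cases hv : c v <;> simp_all

theorem weight_eq_zero {G : SimpleGraph V} {w : Sym2 V → ℝ} (h : ∀ e ∉ G.edgeSet, w e = 0)
    {u v : V} (huv : ¬ G.Adj u v) : w s(u, v) = 0 :=
  h _ (by simpa using huv)

/-- A reachability-closed set contains everything reachable. -/
theorem mem_of_reachable {G : SimpleGraph V} {S : Set V}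
    (hS : ∀ a b, a ∈ S → G.Adj a b → b ∈ S) {a b : V} (h : G.Reachable a b) (ha : a ∈ S) :
    b ∈ S := by
  obtain ⟨p⟩ := h
  induction p with
  | nil => exact ha
  | cons hadj p ih => exact ih (hS _ _ ha hadj)

variable [Fintype V]

/-- The sum of the weights of the edges at `u`. -/
def vsum (w : Sym2 V → ℝ) (u : V) : ℝ := ∑ v, w s(u, v)

/-- A positive edge weighting of `G` (extended by zero) whose sum at every vertex of `R` is `1`. -/
def IsPosWeight (G : SimpleGraph V) (R : Finset V) (w : Sym2 V → ℝ) : Prop :=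
  (∀ e ∈ G.edgeSet, 0 < w e) ∧ (∀ e ∉ G.edgeSet, w e = 0) ∧ ∀ u ∈ R, vsum w u = 1

/-- A weighted form of being matching covered, for a graph whose edges lie inside `R`. -/
structure Covered (G : SimpleGraph V) (R : Finset V) : Prop where
  mem : ∀ u v, G.Adj u v → u ∈ R
  conn : ∀ u ∈ R, ∀ v ∈ R, G.Reachable u v
  card : 4 ≤ R.card
  weight : ∃ w, IsPosWeight G R w

theorem vsum_eq_single {w : Sym2 V → ℝ} {u q : V} (h : ∀ v, v ≠ q → w s(u, v) = 0) :
    vsum w u = w s(u, q) :=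
  Finset.sum_eq_single q (fun v _ hv => h v hv) (by simp)

theorem vsum_eq_pair {w : Sym2 V → ℝ} {u p q : V} (hne : p ≠ q)
    (h : ∀ v, v ≠ p → v ≠ q → w s(u, v) = 0) : vsum w u = w s(u, p) + w s(u, q) :=
  Finset.sum_eq_add_of_mem p q (Finset.mem_univ _) (Finset.mem_univ _) hne
    fun v _ hv => h v hv.1 hv.2

theorem vsum_add (w w' : Sym2 V → ℝ) (u : V) : vsum (w + w') u = vsum w u + vsum w' u := by
  simp [vsum, Finset.sum_add_distrib]

theorem vsum_smul (k : ℝ) (w : Sym2 V → ℝ) (u : V) : vsum (k • w) u = k * vsum w u := by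
  simp [vsum, Finset.mul_sum]

theorem vsum_sum {ι : Type*} (s : Finset ι) (f : ι → Sym2 V → ℝ) (u : V) :
    vsum (∑ i ∈ s, f i) u = ∑ i ∈ s, vsum (f i) u := by
  simp only [vsum, Finset.sum_apply]
  exact Finset.sum_comm

theorem vsum_congr {w w' : Sym2 V → ℝ} {u : V} (h : ∀ v, w s(u, v) = w' s(u, v)) :
    vsum w u = vsum w' u :=
  Finset.sum_congr rfl fun v _ => h v

/-- The signed flow of a weighting out of a vertex set is the signed sum of its vertex sums. -/
theorem sum_cut [DecidableEq V] {G : SimpleGraph V} {c : V → Bool}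
    (hc : ∀ u v, G.Adj u v → c u ≠ c v) {w : Sym2 V → ℝ} (hw : ∀ e ∉ G.edgeSet, w e = 0)
    (S : Finset V) :
    ∑ u ∈ S, sgn c u * ∑ v ∈ Sᶜ, w s(u, v) = ∑ u ∈ S, sgn c u * vsum w u := by
  have h0 : ∑ u ∈ S, ∑ v ∈ S, sgn c u * w s(u, v) = 0 := by
    have h1 : ∑ u ∈ S, ∑ v ∈ S, sgn c u * w s(u, v) =
        ∑ u ∈ S, ∑ v ∈ S, -(sgn c u * w s(u, v)) := by
      conv_lhs => rw [Finset.sum_comm]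
      refine Finset.sum_congr rfl fun u _ => Finset.sum_congr rfl fun v _ => ?_
      by_cases huv : G.Adj u v
      · rw [sgn_eq_neg (hc u v huv), Sym2.eq_swap]; ring
      · rw [weight_eq_zero hw huv, weight_eq_zero hw (fun h => huv h.symm)]; simp
    simp only [Finset.sum_neg_distrib] at h1
    linarith
  have h2 : ∀ u, vsum w u = ∑ v ∈ S, w s(u, v) + ∑ v ∈ Sᶜ, w s(u, v) := fun u =>
    (Finset.sum_add_sum_compl S _).symm
  simp only [h2, mul_add, Finset.sum_add_distrib, Finset.mul_sum]
  rw [h0]; simp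

theorem vsum_single_sgn [DecidableEq V] {c : V → Bool} {u v : V} (h : c u ≠ c v) (a : V) :
    vsum (Pi.single s(u, v) (sgn c u)) a =
      sgn c a * ((if a = u then 1 else 0) - if a = v then 1 else 0) := by
  have hne : u ≠ v := fun h' => h (by rw [h'])
  by_cases ha : a = u
  · subst ha
    rw [vsum_eq_single (q := v)]
    · simp [hne]
    · intro x hx
      simp [Pi.single_apply, hx]
      rintro rfl; exact absurd rfl hne
  · by_cases ha' : a = v
    · subst ha'
      rw [vsum_eq_single (q := u)]
      · simp [Sym2.eq_swap, ha, sgn_eq_neg h]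
      · intro x hx
        simp [hx, ha]
    · simp [vsum, ha', ha]

/-- A walk from `u` to `v`, with alternating signs. -/
theorem exists_alternating [DecidableEq V] {H : SimpleGraph V} {c : V → Bool}
    (hc : ∀ u v, H.Adj u v → c u ≠ c v) {u v : V} (h : H.Reachable u v) :
    ∃ y : Sym2 V → ℝ, (∀ e ∉ H.edgeSet, y e = 0) ∧
      ∀ a, vsum y a = sgn c a * ((if a = u then 1 else 0) - if a = v then 1 else 0) := by
  obtain ⟨p⟩ := h
  induction p with
  | nil => exact ⟨0, by simp, by simp [vsum]⟩
  | @cons u u' v huu' p ih =>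
    obtain ⟨y, hy, hya⟩ := ih
    refine ⟨Pi.single s(u, u') (sgn c u) + y, fun e he => ?_, fun a => ?_⟩
    · have : e ≠ s(u, u') := by rintro rfl; exact he huu'
      simp [hy e he, this]
    · rw [vsum_add, vsum_single_sgn (hc _ _ huu'), hya]; ring

theorem add_le_vsum {w : Sym2 V → ℝ} (hw : ∀ e, 0 ≤ w e) {u p q : V} (hne : p ≠ q) :
    w s(u, p) + w s(u, q) ≤ vsum w u := by
  classical
  rw [← Finset.sum_pair (f := fun v => w s(u, v)) hne]
  exact Finset.sum_le_sum_of_subset_of_nonneg (Finset.subset_univ _) fun _ _ _ => hw _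

theorem IsPosWeight.nonneg {G : SimpleGraph V} {R : Finset V} {w : Sym2 V → ℝ}
    (h : IsPosWeight G R w) (e : Sym2 V) : 0 ≤ w e := by
  by_cases he : e ∈ G.edgeSet
  · exact (h.1 e he).le
  · exact (h.2.1 e he).ge

theorem Covered.exists_adj {G : SimpleGraph V} {R : Finset V} (h : Covered G R) {u : V}
    (hu : u ∈ R) : ∃ v, G.Adj u v := by
  obtain ⟨w, -, hw0, hw1⟩ := h.weight
  by_contra! hcon
  have h0 : ∀ v, w s(u, v) = 0 := fun v => weight_eq_zero hw0 (hcon v)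
  simpa [vsum, h0] using hw1 u hu

/-- In a nonnegative weighting with constant sums, the end of a pendant positive edge has
no further positive edge. -/
theorem eq_zero_of_pendant {w : Sym2 V → ℝ} (hw : ∀ e, 0 ≤ w e) {u v : V} {l : ℝ}
    (hu : vsum w u = l) (hv : vsum w v = l) (h : ∀ x, x ≠ v → w s(u, x) = 0) :
    ∀ x, x ≠ u → w s(v, x) = 0 := by
  intro x hx
  rw [vsum_eq_single h] at hu
  have h1 := add_le_vsum hw (u := v) hx.symm
  rw [Sym2.eq_swap] at hu
  linarith [hw s(v, x)]

theorem Covered.exists_adj_ne {G : SimpleGraph V} {R : Finset V} (h : Covered G R) {u v : V}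
    (huv : G.Adj u v) : ∃ v', v' ≠ v ∧ G.Adj u v' := by
  classical
  obtain ⟨w, hw⟩ := h.weight
  by_contra! hcon
  have hu := h.mem _ _ huv
  have hv := h.mem _ _ huv.symm
  have h1 := eq_zero_of_pendant hw.nonneg (hw.2.2 u hu) (hw.2.2 v hv)
    fun x hx => weight_eq_zero hw.2.1 (hcon x hx)
  have hR : R ⊆ {u, v} := by
    intro x hx
    have := mem_of_reachable (S := {u, v}) ?_ (h.conn u hu x hx) (by simp)
    · simpa using this
    · rintro a b (rfl | rfl) hab
      · by_contra hb
        exact hcon b (fun h => hb (by simp [h])) hab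
      · by_contra hb
        have := h1 b (fun h => hb (by simp [h]))
        exact absurd (hw.1 s(a, b) hab) (by rw [this]; exact lt_irrefl _)
  have := (Finset.card_le_card hR).trans Finset.card_le_two
  have := h.card
  omega

theorem IsPosWeight.lt_one {G : SimpleGraph V} {R : Finset V} (h : Covered G R)
    {w : Sym2 V → ℝ} (hw : IsPosWeight G R w) {u v : V} (huv : G.Adj u v) : w s(u, v) < 1 := by
  obtain ⟨v', hne, hv'⟩ := h.exists_adj_ne huv
  have h1 := add_le_vsum hw.nonneg (u := u) hne
  rw [hw.2.2 u (h.mem _ _ huv)] at h1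
  have := hw.1 s(u, v') hv'
  linarith

/-- Birkhoff's theorem: every edge lies in a perfect matching, given by a permutation. -/
theorem IsPosWeight.exists_perm [DecidableEq V] {G : SimpleGraph V} {R : Finset V}
    (hR : ∀ u v, G.Adj u v → u ∈ R) {w : Sym2 V → ℝ} (hw : IsPosWeight G R w) {a b : V}
    (hab : G.Adj a b) :
    ∃ σ : Equiv.Perm V, (∀ u ∈ R, G.Adj u (σ u)) ∧ σ a = b := by
  let D : Matrix V V ℝ := fun u v => w s(u, v) + if u = v ∧ u ∉ R then 1 else 0
  have hD : ∀ u, ∑ v, D u v = 1 := by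
    intro u
    have h1 : ∑ v, D u v = vsum w u + if u ∉ R then 1 else 0 := by
      simp only [D, Finset.sum_add_distrib]
      congr 1
      by_cases hu : u ∈ R <;> simp [hu]
    rw [h1]
    by_cases hu : u ∈ R
    · simp [hu, hw.2.2 u hu]
    · have : ∀ v, w s(u, v) = 0 := fun v => weight_eq_zero hw.2.1 fun h => hu (hR _ _ h)
      simp [hu, vsum, this]
  have hsymm : ∀ u v, D u v = D v u := by
    intro u v
    simp only [D, Sym2.eq_swap (a := u)]
    congr 1
    by_cases h : u = v
    · subst h; simp
    · simp [h, Ne.symm h]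
  have hmem : D ∈ doublyStochastic ℝ V := by
    rw [mem_doublyStochastic_iff_sum]
    refine ⟨fun u v => ?_, hD, fun v => ?_⟩
    · have := hw.nonneg s(u, v)
      simp only [D]
      split_ifs <;> linarith
    · simp only [hsymm _ v, hD]
  obtain ⟨t, ht0, ht1, htD⟩ := exists_eq_sum_perm_of_mem_doublyStochastic hmem
  have hentry : ∀ u v, D u v = ∑ σ, t σ * (if σ u = v then 1 else 0) := by
    intro u v
    rw [← htD]
    simp [Matrix.sum_apply, Equiv.Perm.permMatrix, PEquiv.toMatrix_apply, Equiv.toPEquiv_apply, eq_comm]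
  have hab' : 0 < D a b := by
    have := hw.1 s(a, b) hab
    simp only [D]
    split_ifs <;> linarith
  rw [hentry] at hab'
  obtain ⟨σ, -, hσ⟩ := Finset.exists_lt_of_sum_lt (s := Finset.univ)
    (f := fun _ : Equiv.Perm V => (0 : ℝ)) (by simpa using hab')
  have hσab : σ a = b := by
    by_contra h
    simp [h] at hσ
  have hσt : 0 < t σ := by simpa [hσab] using hσ
  refine ⟨σ, fun u hu => ?_, hσab⟩
  by_contra hcon
  have h1 : D u (σ u) = 0 := by
    simp [D, weight_eq_zero hw.2.1 hcon, hu]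
  rw [hentry] at h1
  have h2 := (Finset.sum_eq_zero_iff_of_nonneg (fun τ _ =>
    mul_nonneg (ht0 τ) (by split_ifs <;> norm_num))).1 h1 σ (Finset.mem_univ _)
  simp at h2
  linarith

/-- The indicator of a perfect matching through a given edge. -/
theorem Covered.exists_unit [DecidableEq V] {G : SimpleGraph V} {R : Finset V}
    (h : Covered G R) {c : V → Bool} (hc : ∀ u v, G.Adj u v → c u ≠ c v) {a b : V}
    (hab : G.Adj a b) :
    ∃ x : Sym2 V → ℝ, (∀ e, 0 ≤ x e) ∧ (∀ e ∉ G.edgeSet, x e = 0) ∧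
      (∀ u ∈ R, vsum x u = 1) ∧ x s(a, b) = 1 := by
  wlog ha : c a = true generalizing a b
  · obtain ⟨x, h1⟩ := this hab.symm (by have := hc _ _ hab; cases hb : c b <;> simp_all)
    exact ⟨x, by rwa [Sym2.eq_swap (a := a)]⟩
  obtain ⟨w, hw⟩ := h.weight
  obtain ⟨σ, hσ, hσab⟩ := hw.exists_perm h.mem hab
  have hadj : ∀ u v, (c u = true ∧ u ∈ R ∧ σ u = v) → G.Adj u v := by
    rintro u v ⟨-, hu, rfl⟩; exact hσ u hu
  have hex : ∀ u v, (c u = true ∧ u ∈ R ∧ σ u = v) → ¬ (c v = true ∧ v ∈ R ∧ σ v = u) := by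
    intro u v h1 h2
    have := hc _ _ (hadj u v h1)
    simp_all
  let g : V → V → ℝ := fun u v => if c u = true ∧ u ∈ R ∧ σ u = v then 1 else 0
  let x : Sym2 V → ℝ := Sym2.lift ⟨fun u v => g u v + g v u, fun u v => add_comm _ _⟩
  have hx : ∀ u v, x s(u, v) = g u v + g v u := fun u v => rfl
  refine ⟨x, fun e => ?_, fun e he => ?_, fun u hu => ?_, ?_⟩
  · induction e with | _ u v => ?_
    rw [hx]; simp only [g]; split_ifs <;> norm_num
  · induction e with | _ u v => ?_
    have he' : ¬ G.Adj u v := he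
    have h1 := fun h => he' (hadj u v h)
    have h2 := fun h => he' (hadj v u h).symm
    rw [hx]; simp only [g, if_neg h1, if_neg h2, add_zero]
  · cases hcu : c u
    · have hinv : σ.symm u ∈ R := by
        by_contra hcon
        have hS : ∀ v ∈ R, σ v ∈ R := fun v hv => h.mem _ _ (hσ v hv).symm
        have hsurj : R.image σ = R := Finset.eq_of_subset_of_card_le
          (Finset.image_subset_iff.2 hS) (by rw [Finset.card_image_of_injective _ σ.injective])
        rw [← hsurj] at hu
        obtain ⟨v, hv, hvu⟩ := Finset.mem_image.1 hu
        exact hcon (by rw [← hvu]; simpa using hv)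
      have hcs : c (σ.symm u) = true := by
        have := hc _ _ (hσ _ hinv)
        simp only [Equiv.apply_symm_apply, hcu] at this
        simpa using this
      rw [vsum_eq_single (q := σ.symm u)]
      · simp [hx, g, hcu, hinv, hcs]
      · intro v hv
        have : σ v ≠ u := fun h => hv (by simp [← h])
        simp [hx, g, hcu, this]
    · rw [vsum_eq_single (q := σ u)]
      · have := hc _ _ (hσ u hu)
        rw [hcu] at this
        have h2 : c (σ u) = false := by simpa using this
        simp [hx, g, hcu, hu, h2]
      · intro v hv
        by_cases h2 : c v = true ∧ v ∈ R ∧ σ v = u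
        · have := hc _ _ (hadj v u h2)
          simp_all
        · simp [hx, g, h2, Ne.symm hv]
  · have h1 : c a = true ∧ a ∈ R ∧ σ a = b := ⟨ha, h.mem _ _ hab, hσab⟩
    rw [hx]; simp only [g, if_pos h1, if_neg (hex _ _ h1), add_zero]

/-- Positive weightings of a covered graph take every value in `(0, 1)` on a given edge. -/
theorem Covered.exists_weight_eq [DecidableEq V] {G : SimpleGraph V} {R : Finset V}
    (h : Covered G R) {c : V → Bool} (hc : ∀ u v, G.Adj u v → c u ≠ c v) {a b : V}
    (hab : G.Adj a b) {t : ℝ} (ht0 : 0 < t) (ht1 : t < 1) :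
    ∃ w, IsPosWeight G R w ∧ w s(a, b) = t := by
  obtain ⟨w, hw⟩ := h.weight
  have hmix : ∀ x : Sym2 V → ℝ, (∀ e, 0 ≤ x e) → (∀ e ∉ G.edgeSet, x e = 0) →
      (∀ u ∈ R, vsum x u = 1) → ∀ θ : ℝ, 0 ≤ θ → θ < 1 →
      IsPosWeight G R ((1 - θ) • w + θ • x) := by
    intro x hx0 hxe hx1 θ h0 h1
    refine ⟨fun e he => ?_, fun e he => ?_, fun u hu => ?_⟩
    · have h2 : 0 < (1 - θ) * w e := mul_pos (by linarith) (hw.1 e he)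
      have h3 : 0 ≤ θ * x e := mul_nonneg h0 (hx0 e)
      simp only [Pi.add_apply, Pi.smul_apply, smul_eq_mul]
      linarith
    · simp [hw.2.1 e he, hxe e he]
    · rw [vsum_add, vsum_smul, vsum_smul, hw.2.2 u hu, hx1 u hu]; ring
  have hp := hw.1 s(a, b) hab
  have hq := hw.lt_one h hab
  set p := w s(a, b) with hpdef
  rcases le_or_gt p t with hpt | hpt
  · obtain ⟨x, hx0, hxe, hx1, hxab⟩ := h.exists_unit hc hab
    refine ⟨_, hmix x hx0 hxe hx1 ((t - p) / (1 - p)) (div_nonneg (by linarith) (by linarith))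
      ((div_lt_one (by linarith)).2 (by linarith)), ?_⟩
    have : (1 - p) ≠ 0 := by linarith
    simp only [Pi.add_apply, Pi.smul_apply, smul_eq_mul, hxab, ← hpdef]
    field_simp
    ring
  · obtain ⟨b', hne, hab'⟩ := h.exists_adj_ne hab
    obtain ⟨x, hx0, hxe, hx1, hxab⟩ := h.exists_unit hc hab'
    have hx : x s(a, b) = 0 := by
      have h1 := add_le_vsum hx0 (u := a) hne
      rw [hx1 a (h.mem _ _ hab)] at h1
      linarith [hx0 s(a, b)]
    refine ⟨_, hmix x hx0 hxe hx1 ((p - t) / p) (div_nonneg (by linarith) (by linarith))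
      ((div_lt_one (by linarith)).2 (by linarith)), ?_⟩
    simp only [Pi.add_apply, Pi.smul_apply, smul_eq_mul, hx, ← hpdef]
    field_simp
    ring

end Weights

section Facets

/-- The subgraph of `G` spanned by the edges inside `S`. -/
def within {V : Type*} (G : SimpleGraph V) (S : Finset V) : SimpleGraph V where
  Adj u v := G.Adj u v ∧ u ∈ S ∧ v ∈ S
  symm := ⟨fun _ _ h => ⟨h.1.symm, h.2.2, h.2.1⟩⟩
  loopless := ⟨fun _ h => h.1.ne rfl⟩

/-- The subgraph of `G` of the edges of positive weight. -/
def supp {V : Type*} (G : SimpleGraph V) (z : Sym2 V → ℝ) : SimpleGraph V where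
  Adj u v := G.Adj u v ∧ 0 < z s(u, v)
  symm := ⟨fun _ _ h => ⟨h.1.symm, by rw [Sym2.eq_swap]; exact h.2⟩⟩
  loopless := ⟨fun _ h => h.1.ne rfl⟩

/-- The vertex sets `S` and `R \ S` are both connected in `G`, and are joined by exactly the two
edges `s(a, a')` and `s(b, b')`, whose ends `a` and `b` in `S` have different colours. -/
structure IsTie {V : Type*} [DecidableEq V] (c : V → Bool) (G : SimpleGraph V) (R S : Finset V)
    (a a' b b' : V) : Prop where
  subset : S ⊆ R
  mem_a : a ∈ S
  mem_b : b ∈ S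
  mem_a' : a' ∈ R \ S
  mem_b' : b' ∈ R \ S
  adj_a : G.Adj a a'
  adj_b : G.Adj b b'
  color : c a ≠ c b
  eq_of_adj : ∀ u ∈ S, ∀ v ∉ S, G.Adj u v → (u = a ∧ v = a') ∨ (u = b ∧ v = b')
  conn : ∀ u ∈ S, ∀ v ∈ S, (within G S).Reachable u v
  conn_compl : ∀ u ∈ R \ S, ∀ v ∈ R \ S, (within G (R \ S)).Reachable u v
  sum_sgn : ∑ u ∈ S, sgn c u = 0
  sum_sgn_compl : ∑ u ∈ R \ S, sgn c u = 0

variable {V : Type*}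

theorem supp_le {G : SimpleGraph V} {z : Sym2 V → ℝ} : supp G z ≤ G := fun _ _ h => h.1

theorem within_le {G : SimpleGraph V} {S : Finset V} : within G S ≤ G := fun _ _ h => h.1

theorem IsTie.symm [DecidableEq V] {c : V → Bool} {G : SimpleGraph V}
    (hc : ∀ u v, G.Adj u v → c u ≠ c v) {R S : Finset V} {a a' b b' : V}
    (hR : ∀ u v, G.Adj u v → u ∈ R)
    (h : IsTie c G R S a a' b b') : IsTie c G R (R \ S) a' a b' b where
  subset := Finset.sdiff_subset
  mem_a := h.mem_a'
  mem_b := h.mem_b'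
  mem_a' := by rw [Finset.sdiff_sdiff_eq_self h.subset]; exact h.mem_a
  mem_b' := by rw [Finset.sdiff_sdiff_eq_self h.subset]; exact h.mem_b
  adj_a := h.adj_a.symm
  adj_b := h.adj_b.symm
  color := by
    have h1 := hc _ _ h.adj_a
    have h2 := hc _ _ h.adj_b
    have h3 := h.color
    revert h1 h2 h3
    cases c a <;> cases c a' <;> cases c b <;> cases c b' <;> simp
  eq_of_adj := by
    intro u hu v hv huv
    have hv' : v ∈ S := by
      by_contra hvS
      exact hv (Finset.mem_sdiff.2 ⟨hR _ _ huv.symm, hvS⟩)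
    rcases h.eq_of_adj v hv' u (Finset.mem_sdiff.1 hu).2 huv.symm with ⟨h1, h2⟩ | ⟨h1, h2⟩
    · exact Or.inl ⟨h2, h1⟩
    · exact Or.inr ⟨h2, h1⟩
  conn := h.conn_compl
  conn_compl := by rw [Finset.sdiff_sdiff_eq_self h.subset]; exact h.conn
  sum_sgn := h.sum_sgn_compl
  sum_sgn_compl := by rw [Finset.sdiff_sdiff_eq_self h.subset]; exact h.sum_sgn

variable [Fintype V]

/-- A weighted form of being minimal matching covered. -/
def MinCovered (G : SimpleGraph V) (R : Finset V) : Prop :=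
  Covered G R ∧ ∀ e ∈ G.edgeSet, ¬ Covered (G.deleteEdges {e}) R

/-- The edge weightings of `G` with constant vertex sums on `R`. -/
def balanced (G : SimpleGraph V) (R : Finset V) : Submodule ℝ (Sym2 V → ℝ) where
  carrier := {w | (∀ e ∉ G.edgeSet, w e = 0) ∧ ∃ l, ∀ u ∈ R, vsum w u = l}
  add_mem' := by
    rintro w w' ⟨h, l, hl⟩ ⟨h', l', hl'⟩
    exact ⟨fun e he => by simp [h e he, h' e he], l + l', fun u hu => by
      rw [vsum_add, hl u hu, hl' u hu]⟩
  zero_mem' := ⟨fun _ _ => rfl, 0, fun u _ => by simp [vsum]⟩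
  smul_mem' := by
    rintro k w ⟨h, l, hl⟩
    exact ⟨fun e he => by simp [h e he], k * l, fun u hu => by rw [vsum_smul, hl u hu]⟩

/-- A nonnegative weighting vanishing at `e`, such that the balanced weightings are positively
proportional to their value at `e` on all edges where it vanishes. -/
structure IsFacet (G : SimpleGraph V) (R : Finset V) (z : Sym2 V → ℝ) (e : Sym2 V) : Prop where
  nonneg : ∀ f, 0 ≤ z f
  off : ∀ f ∉ G.edgeSet, z f = 0
  sum_eq : ∀ u ∈ R, vsum z u = 1
  edge : e ∈ G.edgeSet
  zero : z e = 0
  rigid : ∀ f ∈ G.edgeSet, z f = 0 → ∃ k > 0, ∀ x ∈ balanced G R, x f = k * x e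

theorem IsFacet.pos {G : SimpleGraph V} {R : Finset V} {z : Sym2 V → ℝ} {e f : Sym2 V}
    (h : IsFacet G R z e) (hf : z f ≠ 0) : 0 < z f :=
  lt_of_le_of_ne (h.nonneg f) hf.symm

theorem IsFacet.eq_zero_of_not_supp {G : SimpleGraph V} {R : Finset V} {z : Sym2 V → ℝ}
    {e : Sym2 V} (h : IsFacet G R z e) {u v : V} (huv : ¬ (supp G z).Adj u v) :
    z s(u, v) = 0 := by
  by_contra hne
  by_cases hadj : G.Adj u v
  · exact huv ⟨hadj, h.pos hne⟩
  · exact hne (weight_eq_zero h.off hadj)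

theorem IsFacet.exists_not_reachable {G : SimpleGraph V} {R : Finset V}
    {c : V → Bool} (hc : ∀ u v, G.Adj u v → c u ≠ c v) {z : Sym2 V → ℝ} {e : Sym2 V}
    (hG : MinCovered G R) (h : IsFacet G R z e) :
    ∃ u ∈ R, ∃ v ∈ R, ¬ (supp G z).Reachable u v := by
  classical
  by_contra! hcon
  have huniq : ∀ f ∈ G.edgeSet, z f = 0 → f = e := by
    intro f hf hzf
    by_contra hfe
    induction f with | _ a b => ?_
    have hab : G.Adj a b := hf
    obtain ⟨y, hy, hya⟩ := exists_alternating (fun u v h => hc u v (supp_le h))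
      (hcon b (hG.1.mem _ _ hab.symm) a (hG.1.mem _ _ hab))
    obtain ⟨k, -, hk⟩ := h.rigid _ hf hzf
    have hnot : ∀ f, z f = 0 → y f = 0 := by
      intro f hf
      refine hy f fun hfs => ?_
      induction f with | _ p q => ?_
      exact absurd hfs.2 (by rw [hf]; exact lt_irrefl _)
    have h1 := hk (Pi.single s(a, b) (sgn c a) + y) ⟨fun f hf => ?_, 0, fun u _ => ?_⟩
    · simp [hnot _ hzf, hnot _ h.zero, Ne.symm hfe, sgn_ne_zero] at h1
    · have h2 : f ≠ s(a, b) := by rintro rfl; exact hf hab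
      simp [h2, hnot f (h.off f hf)]
    · rw [vsum_add, vsum_single_sgn (hc _ _ hab), hya]; ring
  have hne : ∀ f ∈ (G.deleteEdges {e}).edgeSet, 0 < z f := by
    intro f hf
    rw [edgeSet_deleteEdges] at hf
    exact h.pos fun h0 => hf.2 (huniq f hf.1 h0)
  refine hG.2 e h.edge ⟨fun u v huv => hG.1.mem u v (deleteEdges_le _ huv), fun u hu v hv => ?_,
    hG.1.card, z, hne, fun f hf => ?_, h.sum_eq⟩
  · refine (hcon u hu v hv).mono fun p q hpq => ?_
    rw [deleteEdges_adj]
    refine ⟨hpq.1, fun hpe => ?_⟩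
    have := hpq.2
    rw [Set.mem_singleton_iff.1 hpe, h.zero] at this
    exact lt_irrefl _ this
  · by_cases hfe : f = e
    · rw [hfe, h.zero]
    · exact h.off f fun hf' => hf (by rw [edgeSet_deleteEdges]; exact ⟨hf', hfe⟩)

theorem IsFacet.sum_sgn {G : SimpleGraph V} {R : Finset V}
    {c : V → Bool} (hc : ∀ u v, G.Adj u v → c u ≠ c v) {z : Sym2 V → ℝ} {e : Sym2 V}
    (h : IsFacet G R z e) {T : Finset V} (hT : T ⊆ R)
    (hcl : ∀ u ∈ T, ∀ v, (supp G z).Adj u v → v ∈ T) : ∑ u ∈ T, sgn c u = 0 := by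
  classical
  have h1 := sum_cut hc h.off T
  rw [Finset.sum_eq_zero (fun u hu => ?_), Finset.sum_congr rfl (fun u hu => by
    rw [h.sum_eq u (hT hu), mul_one])] at h1
  · exact h1.symm
  · rw [Finset.sum_eq_zero (fun v hv => ?_), mul_zero]
    exact h.eq_zero_of_not_supp fun hadj => Finset.mem_compl.1 hv (hcl u hu v hadj)

theorem IsFacet.exists_isTie [DecidableEq V] {G : SimpleGraph V} {R : Finset V}
    {c : V → Bool} (hc : ∀ u v, G.Adj u v → c u ≠ c v) {z : Sym2 V → ℝ} {e : Sym2 V}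
    (hG : Covered G R) (h : IsFacet G R z e) {S : Finset V} (hS : S ⊆ R) (hne : S.Nonempty)
    (hSR : S ≠ R) (hcl : ∀ u ∈ S, ∀ v, (supp G z).Adj u v → v ∈ S)
    (hconn : ∀ u ∈ S, ∀ v ∈ S, (supp G z).Reachable u v) :
    ∃ a a' b b', IsTie c G R S a a' b b' := by
  have hmemR : ∀ {u v}, G.Adj u v → v ∈ R := fun huv => hG.mem _ _ huv.symm
  have hcl' : ∀ u ∉ S, ∀ v, (supp G z).Adj u v → v ∉ S := fun u hu v huv hv =>
    hu (hcl v hv u huv.symm)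
  obtain ⟨a, ha, a', ha', haa'⟩ : ∃ a ∈ S, ∃ a' ∉ S, G.Adj a a' := by
    by_contra! hcon
    obtain ⟨s, hs⟩ := hne
    refine hSR (Finset.Subset.antisymm hS fun t ht => ?_)
    exact mem_of_reachable (S := {x | x ∈ S}) (fun u v hu huv => by_contra fun hv =>
      hcon u hu v hv huv) (hG.conn s (hS hs) t ht) hs
  have hac := hc _ _ haa'
  have ha'T : a' ∈ R \ S := Finset.mem_sdiff.2 ⟨hmemR haa', ha'⟩
  classical
  let T := (R \ S).filter fun v => (within G (R \ S)).Reachable a' v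
  have hT : ∀ v, v ∈ T ↔ v ∈ R \ S ∧ (within G (R \ S)).Reachable a' v := by simp [T]
  have hTstep : ∀ u ∈ T, ∀ v, G.Adj u v → v ∉ S → v ∈ T := by
    intro u hu v huv hv
    have hv' : v ∈ R \ S := Finset.mem_sdiff.2 ⟨hmemR huv, hv⟩
    have hu' := (hT u).1 hu
    exact (hT v).2 ⟨hv', hu'.2.trans (SimpleGraph.Adj.reachable ⟨huv, hu'.1, hv'⟩)⟩
  have ha'' : a' ∈ T := (hT a').2 ⟨ha'T, Reachable.refl _⟩
  have hTS : ∀ u ∈ T, u ∉ S := fun u hu => (Finset.mem_sdiff.1 ((hT u).1 hu).1).2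
  obtain ⟨b', hb', b, hb, hbb', hne'⟩ :
      ∃ b' ∈ T, ∃ b ∉ T, G.Adj b' b ∧ ¬ (b' = a' ∧ b = a) := by
    by_contra hno
    have hcon : ∀ u ∈ T, ∀ v ∉ T, G.Adj u v → u = a' ∧ v = a := fun u hu v hv huv =>
      by_contra fun hn => hno ⟨u, hu, v, hv, huv, hn⟩
    obtain ⟨x, hx⟩ := hG.weight
    have h1 := sum_cut hc hx.2.1 T
    have h2 : ∑ u ∈ T, sgn c u * vsum x u = ∑ u ∈ T, sgn c u :=
      Finset.sum_congr rfl fun u hu => by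
        rw [hx.2.2 u (Finset.sdiff_subset ((hT u).1 hu).1), mul_one]
    rw [h2, h.sum_sgn hc (fun u hu => Finset.sdiff_subset ((hT u).1 hu).1) (fun u hu v huv =>
        hTstep u hu v huv.1 (hcl' u (hTS u hu) v huv)), Finset.sum_eq_single a'] at h1
    · rw [Finset.sum_eq_single a] at h1
      · have := hx.1 s(a', a) haa'.symm
        exact (mul_ne_zero (sgn_ne_zero c a') this.ne') h1
      · intro v hv hva
        exact weight_eq_zero hx.2.1 fun hadj =>
          hva (hcon a' ha'' v (Finset.mem_compl.1 hv) hadj).2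
      · intro hn
        exact absurd (Finset.mem_compl.2 fun haT => hTS a haT ha) hn
    · intro u hu hua
      rw [Finset.sum_eq_zero, mul_zero]
      intro v hv
      exact weight_eq_zero hx.2.1 fun hadj => hua (hcon u hu v (Finset.mem_compl.1 hv) hadj).1
    · exact fun hn => absurd ha'' hn
  have hbS : b ∈ S := by_contra fun hbS => hb (hTstep b' hb' b hbb' hbS)
  have hbc := hc _ _ hbb'
  have hb'S := hTS b' hb'
  obtain ⟨y, hy, hya⟩ := exists_alternating (fun u v h => hc u v (within_le h))
    ((hT b').1 hb').2
  obtain ⟨y', hy', hya'⟩ := exists_alternating (fun u v h => hc u v (supp_le h))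
    (hconn b hbS a ha)
  have hycut : ∀ u v, u ∈ S → v ∉ S → y s(u, v) = 0 ∧ y' s(u, v) = 0 := by
    intro u v hu hv
    exact ⟨hy _ fun hadj => (Finset.mem_sdiff.1 hadj.2.1).2 hu,
      hy' _ fun hadj => hv (hcl u hu v hadj)⟩
  have hzcut : ∀ u v, u ∈ S → v ∉ S → z s(u, v) = 0 := fun u v hu hv =>
    h.eq_zero_of_not_supp fun hadj => hv (hcl u hu v hadj)
  let Y : Sym2 V → ℝ := Pi.single s(a, a') (sgn c a) + y + Pi.single s(b', b) (sgn c b') + y'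
  have hYmem : Y ∈ balanced G R := by
    refine ⟨fun f hf => ?_, 0, fun u _ => ?_⟩
    · have h1 : f ≠ s(a, a') := by rintro rfl; exact hf haa'
      have h2 : f ≠ s(b', b) := by rintro rfl; exact hf hbb'
      have h3 : y f = 0 := hy f fun h => hf (edgeSet_mono within_le h)
      have h4 : y' f = 0 := hy' f fun h => hf (edgeSet_mono supp_le h)
      simp [Y, h1, h2, h3, h4]
    · simp only [Y, vsum_add, vsum_single_sgn hac, vsum_single_sgn hbc, hya, hya']; ring
  have hdist : s(a, a') ≠ s(b', b) := by
    intro heq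
    rcases Sym2.eq_iff.1 heq with ⟨h1, h2⟩ | ⟨h1, h2⟩
    · exact hb'S (h1 ▸ ha)
    · exact hne' ⟨h2.symm, h1.symm⟩
  have hYa : Y s(a, a') = sgn c a := by
    simp [Y, hycut a a' ha ha', hdist]
  have hYb : Y s(b', b) = sgn c b' := by
    have := hycut b b' hbS hb'S
    rw [Sym2.eq_swap] at this
    simp [Y, this, hdist.symm]
  obtain ⟨k, hk, hka⟩ := h.rigid _ haa' (hzcut a a' ha ha')
  have hYe : Y e ≠ 0 := by
    intro h0
    have := hka Y hYmem
    rw [hYa, h0, mul_zero] at this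
    exact sgn_ne_zero c a this
  have honly : ∀ u ∈ S, ∀ v ∉ S, G.Adj u v → (u = a ∧ v = a') ∨ (u = b ∧ v = b') := by
    intro u hu v hv huv
    by_contra! hcon
    obtain ⟨k', hk', hk'a⟩ := h.rigid _ huv (hzcut u v hu hv)
    have h1 := hk'a Y hYmem
    have h2 : s(u, v) ≠ s(a, a') := by
      intro heq
      rcases Sym2.eq_iff.1 heq with ⟨h1, h2⟩ | ⟨h1, h2⟩
      · exact hcon.1 h1 h2
      · exact hv (h2 ▸ ha)
    have h3 : s(u, v) ≠ s(b', b) := by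
      intro heq
      rcases Sym2.eq_iff.1 heq with ⟨h1, h2⟩ | ⟨h1, h2⟩
      · exact hb'S (h1 ▸ hu)
      · exact hcon.2 h1 h2
    have h4 : Y s(u, v) = 0 := by simp [Y, h2, h3, hycut u v hu hv]
    rw [h4] at h1
    exact mul_ne_zero hk'.ne' hYe h1.symm
  have hconn' : ∀ u ∈ R \ S, (within G (R \ S)).Reachable a' u := by
    intro u hu
    have h1 := mem_of_reachable (S := {x | x ∈ S ∨ x ∈ T}) ?_
      (hG.conn a (hS ha) u (Finset.sdiff_subset hu)) (Or.inl ha)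
    · exact ((hT u).1 (h1.resolve_left (Finset.mem_sdiff.1 hu).2)).2
    · rintro p q (hp | hp) hpq <;> by_cases hq : q ∈ S
      · exact Or.inl hq
      · rcases honly p hp q hq hpq with ⟨-, rfl⟩ | ⟨-, rfl⟩
        · exact Or.inr ha''
        · exact Or.inr hb'
      · exact Or.inl hq
      · exact Or.inr (hTstep p hp q hpq hq)
  refine ⟨a, a', b, b', hS, ha, hbS, ha'T, ((hT b').1 hb').1, haa', hbb'.symm, ?_, honly, ?_, ?_,
    h.sum_sgn hc hS hcl, h.sum_sgn hc Finset.sdiff_subset fun u hu v huv => Finset.mem_sdiff.2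
      ⟨hmemR huv.1, hcl' u (Finset.mem_sdiff.1 hu).2 v huv⟩⟩
  · intro heq
    obtain ⟨k', hk', hk'a⟩ := h.rigid s(b', b) hbb' (by
      rw [Sym2.eq_swap]; exact hzcut b b' hbS hb'S)
    have h1 := hka Y hYmem
    have h2 := hk'a Y hYmem
    rw [hYa] at h1
    rw [hYb, sgn_eq_neg hbc] at h2
    have h3 : sgn c a = sgn c b := by simp [sgn, heq]
    have h4 : (k + k') * Y e = 0 := by linarith
    exact mul_ne_zero (by positivity) hYe h4
  · intro u hu v hv
    obtain ⟨p⟩ := hconn u hu v hv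
    induction p with
    | nil => exact Reachable.refl _
    | cons hadj p ih =>
      have hm := hcl _ hu _ hadj
      exact (show (within G S).Adj _ _ from ⟨hadj.1, hu, hm⟩).reachable.trans (ih hm hv)
  · exact fun u hu v hv => (hconn' u hu).symm.trans (hconn' v hv)

end Facets

section Dimension

variable {V : Type*} [Fintype V]

theorem degN_eq_degree (G : SimpleGraph V) [DecidableRel G.Adj] (u : V) :
    degN G u = G.degree u := by
  rw [degN, Set.ncard_eq_toFinset_card', ← card_neighborFinset_eq_degree]
  rfl

theorem sum_degN {G : SimpleGraph V} {R : Finset V} (hR : ∀ u v, G.Adj u v → u ∈ R) :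
    ∑ u ∈ R, degN G u = 2 * G.edgeSet.ncard := by
  classical
  rw [← coe_edgeFinset, Set.ncard_coe_finset, ← sum_degrees_eq_twice_card_edges]
  simp only [degN_eq_degree]
  refine Finset.sum_subset (Finset.subset_univ _) fun u _ hu => ?_
  rw [← card_neighborFinset_eq_degree, Finset.card_eq_zero, Finset.eq_empty_iff_forall_notMem]
  exact fun v hv => hu (hR u v (by simpa using hv))

theorem Covered.two_le_degN {G : SimpleGraph V} {R : Finset V} (h : Covered G R) {u : V}
    (hu : u ∈ R) : 2 ≤ degN G u := by
  obtain ⟨v, hv⟩ := h.exists_adj hu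
  obtain ⟨v', hne, hv'⟩ := h.exists_adj_ne hv
  exact (Set.one_lt_ncard (Set.toFinite _)).2 ⟨v, hv, v', hv', hne.symm⟩

theorem Covered.card_le {G : SimpleGraph V} {R : Finset V} (h : Covered G R) :
    R.card ≤ G.edgeSet.ncard := by
  have h1 := Finset.card_nsmul_le_sum R (degN G) 2 fun u hu => h.two_le_degN hu
  rw [sum_degN h.mem, smul_eq_mul] at h1
  omega

theorem sum_sgn_mul_vsum {G : SimpleGraph V} {R : Finset V} (hR : ∀ u v, G.Adj u v → u ∈ R)
    {c : V → Bool} (hc : ∀ u v, G.Adj u v → c u ≠ c v) {w : Sym2 V → ℝ}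
    (hw : ∀ e ∉ G.edgeSet, w e = 0) : ∑ u ∈ R, sgn c u * vsum w u = 0 := by
  classical
  rw [← sum_cut hc hw R]
  refine Finset.sum_eq_zero fun u _ => ?_
  rw [Finset.sum_eq_zero, mul_zero]
  exact fun v hv => weight_eq_zero hw fun h => Finset.mem_compl.1 hv (hR _ _ h.symm)

theorem Covered.sum_sgn {G : SimpleGraph V} {R : Finset V} (h : Covered G R)
    {c : V → Bool} (hc : ∀ u v, G.Adj u v → c u ≠ c v) : ∑ u ∈ R, sgn c u = 0 := by
  obtain ⟨w, hw⟩ := h.weight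
  rw [← sum_sgn_mul_vsum h.mem hc hw.2.1]
  exact Finset.sum_congr rfl fun u hu => by rw [hw.2.2 u hu, mul_one]

theorem Covered.le_finrank_balanced {G : SimpleGraph V} {R : Finset V} (h : Covered G R)
    {c : V → Bool} (hc : ∀ u v, G.Adj u v → c u ≠ c v) :
    G.edgeSet.ncard + 2 ≤ Module.finrank ℝ (balanced G R) + R.card := by
  classical
  obtain ⟨a, ha⟩ : R.Nonempty := Finset.card_pos.1 (by have := h.card; omega)
  obtain ⟨b, hab⟩ := h.exists_adj ha
  have hb : b ∈ R := h.mem _ _ hab.symm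
  let N : Finset (Sym2 V) := G.edgeFinsetᶜ
  let P : Finset V := (R.erase a).erase b
  let Θ : (Sym2 V → ℝ) →ₗ[ℝ] (N → ℝ) × (P → ℝ) :=
    { toFun := fun w => (fun e => w e, fun v => vsum w v - vsum w a)
      map_add' := fun w w' => by
        ext <;> simp [vsum_add]; ring
      map_smul' := fun k w => by
        ext <;> simp [vsum_smul]; ring }
  have hker : LinearMap.ker Θ ≤ balanced G R := by
    intro w hw
    rw [LinearMap.mem_ker, Prod.ext_iff] at hw
    have h1 : ∀ e ∉ G.edgeSet, w e = 0 := fun e he =>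
      congrFun hw.1 ⟨e, by simpa [N] using he⟩
    have h2 : ∀ v ∈ R, v ≠ b → vsum w v - vsum w a = 0 := by
      intro v hv hvb
      by_cases hva : v = a
      · rw [hva, sub_self]
      · exact congrFun hw.2 ⟨v, by simp [P, hv, hvb, hva]⟩
    refine ⟨h1, vsum w a, fun u hu => ?_⟩
    by_cases hub : u = b
    · subst hub
      have h3 : ∑ v ∈ R, sgn c v * (vsum w v - vsum w a) = 0 := by
        simp only [mul_sub, Finset.sum_sub_distrib, ← Finset.sum_mul]
        rw [sum_sgn_mul_vsum h.mem hc h1, h.sum_sgn hc]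
        ring
      rw [Finset.sum_eq_single_of_mem u hb fun v hv hvb => by rw [h2 v hv hvb, mul_zero]] at h3
      linarith [(mul_eq_zero.1 h3).resolve_left (sgn_ne_zero c u)]
    · linarith [h2 u hu hub]
  have h1 := LinearMap.finrank_range_add_finrank_ker Θ
  have h2 := Submodule.finrank_le (LinearMap.range Θ)
  have h3 := Submodule.finrank_mono hker
  have hN : N.card + G.edgeSet.ncard = Fintype.card (Sym2 V) := by
    rw [← coe_edgeFinset, Set.ncard_coe_finset, add_comm]
    exact Finset.card_add_card_compl _
  have hP : P.card + 2 = R.card := by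
    rw [Finset.card_erase_of_mem (by simp [hb, hab.ne']), Finset.card_erase_of_mem ha]
    have := h.card
    omega
  simp only [Module.finrank_prod, Module.finrank_fintype_fun_eq_card, Fintype.card_coe] at h1 h2
  omega

theorem Covered.exists_isFacet {G : SimpleGraph V} {R : Finset V} (h : Covered G R)
    {c : V → Bool} (hc : ∀ u v, G.Adj u v → c u ≠ c v) :
    ∃ I : Finset (Sym2 V), G.edgeSet.ncard + 2 ≤ I.card + R.card ∧
      ∀ e ∈ I, ∃ z, IsFacet G R z e ∧ ∀ e' ∈ I, e' ≠ e → 0 < z e' := by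
  obtain ⟨x, hx⟩ := h.weight
  obtain ⟨I, hIE, hI, hz⟩ := exists_facets (balanced G R) G.edgeSet (fun w hw => hw.1) x
    ⟨hx.2.1, 1, hx.2.2⟩ hx.1
  have hcard := h.le_finrank_balanced hc
  refine ⟨I, by omega, fun e he => ?_⟩
  obtain ⟨z, ⟨hz0, l, hl⟩, hnn, hze, hpos, hrig⟩ := hz e he
  obtain ⟨e', he', hne⟩ := Finset.exists_mem_ne (s := I) (by have := h.card_le; omega) e
  have hlpos : 0 < l := by
    have h1 := hpos e' he' hne
    have h2 := hIE e' he'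
    induction e' with | _ p q => ?_
    rw [← hl p (h.mem _ _ h2)]
    exact h1.trans_le (Finset.single_le_sum (f := fun v => z s(p, v)) (fun v _ => hnn _)
      (Finset.mem_univ q))
  have hl' : l⁻¹ ≠ 0 := inv_ne_zero hlpos.ne'
  refine ⟨l⁻¹ • z, ⟨fun f => mul_nonneg (inv_nonneg.2 hlpos.le) (hnn f),
    fun f hf => by simp [hz0 f hf], fun u hu => ?_, hIE e he, by simp [hze], fun f hf hzf => ?_⟩,
    fun e' he' hne => mul_pos (inv_pos.2 hlpos) (hpos e' he' hne)⟩
  · rw [vsum_smul, hl u hu, inv_mul_cancel₀ hlpos.ne']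
  · exact hrig f hf ((mul_eq_zero.1 hzf).resolve_left hl')

end Dimension

section Pendant

variable {V : Type*}

theorem exists_eq_pair_of_degN {G : SimpleGraph V} {u v : V} (h : degN G u = 2)
    (huv : G.Adj u v) : ∃ u', u' ≠ v ∧ G.neighborSet u = {v, u'} := by
  obtain ⟨x, y, hxy, hN⟩ := Set.ncard_eq_two.1 h
  have : v ∈ G.neighborSet u := huv
  rw [hN] at this
  rcases this with rfl | h1
  · exact ⟨y, hxy.symm, hN⟩
  · rw [Set.mem_singleton_iff.1 h1]
    exact ⟨x, hxy, by rw [hN, Set.pair_comm]⟩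

variable [Fintype V]

/-- `q` is the only neighbour of `v` along edges of positive weight. -/
def Pendant (G : SimpleGraph V) (z : Sym2 V → ℝ) (v q : V) : Prop :=
  (supp G z).Adj v q ∧ ∀ y, (supp G z).Adj v y → y = q

/-- `G` has an induced matching of at least `m - n + 2` edges with ends of degree two, where
`m` is the number of its edges and `n` is the cardinality of `R`. -/
def HasTwoEdgeMatching (G : SimpleGraph V) (R : Finset V) : Prop :=
  ∃ F : Set (Sym2 V), IsInducedMatching G F ∧ (∀ e ∈ F, IsTwoEdge G e) ∧
    G.edgeSet.ncard + 2 ≤ F.ncard + R.card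

theorem Pendant.symm {G : SimpleGraph V} {R : Finset V} (hG : Covered G R) {z : Sym2 V → ℝ}
    {e : Sym2 V} (h : IsFacet G R z e) {v q : V} (hp : Pendant G z v q) : Pendant G z q v := by
  refine ⟨hp.1.symm, fun x hx => by_contra fun hne => ?_⟩
  have := eq_zero_of_pendant h.nonneg (h.sum_eq v (hG.mem _ _ hp.1.1))
    (h.sum_eq q (hG.mem _ _ hp.1.1.symm))
    (fun y hy => h.eq_zero_of_not_supp fun hadj => hy (hp.2 y hadj)) x hne
  exact absurd hx.2 (by rw [this]; exact lt_irrefl _)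

theorem Pendant.exists_nbr {G : SimpleGraph V} {R : Finset V} (hG : Covered G R)
    {c : V → Bool} (hc : ∀ u v, G.Adj u v → c u ≠ c v) {z : Sym2 V → ℝ}
    {e : Sym2 V} (h : IsFacet G R z e) {v q : V} (hp : Pendant G z v q) :
    ∃ v', v' ≠ q ∧ G.neighborSet v = {q, v'} ∧ z s(v, v') = 0 := by
  classical
  have hq := hp.symm hG h
  have hvR := hG.mem _ _ hp.1.1
  have hqR := hG.mem _ _ hp.1.1.symm
  obtain ⟨a, a', b, b', ht⟩ := h.exists_isTie hc hG (S := {v, q})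
    (by simp [Finset.insert_subset_iff, hvR, hqR]) (by simp)
    (fun heq => by
      have h1 := hG.card
      have h2 : ({v, q} : Finset V).card ≤ 2 := Finset.card_le_two
      rw [heq] at h2
      omega)
    (by
      intro u hu x hux
      rcases (by simpa using hu : u = v ∨ u = q) with rfl | rfl
      · simp [hp.2 x hux]
      · simp [hq.2 x hux])
    (by
      intro u hu x hx
      rcases (by simpa using hu : u = v ∨ u = q) with rfl | rfl <;>
      rcases (by simpa using hx : x = _ ∨ x = _) with rfl | rfl
      · exact Reachable.refl _
      · exact hp.1.reachable
      · exact hq.1.reachable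
      · exact Reachable.refl _)
  have hab : a ≠ b := fun h => ht.color (by rw [h])
  obtain ⟨v', hv', hadj, hon⟩ : ∃ v' ∉ ({v, q} : Finset V), G.Adj v v' ∧
      ∀ x ∉ ({v, q} : Finset V), G.Adj v x → x = v' := by
    have ha := ht.mem_a
    have hb := ht.mem_b
    rcases (by simpa using ha : a = v ∨ a = q) with h1 | h1
    · refine ⟨a', (Finset.mem_sdiff.1 ht.mem_a').2, h1 ▸ ht.adj_a, fun x hx hvx => ?_⟩
      rcases ht.eq_of_adj v (by simp) x hx hvx with h2 | h2
      · exact h2.2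
      · exact absurd (h1.trans h2.1) hab
    · have h2 : b = v := (by simpa using hb : b = v ∨ b = q).resolve_right
        fun h2 => hab (h1.trans h2.symm)
      refine ⟨b', (Finset.mem_sdiff.1 ht.mem_b').2, h2 ▸ ht.adj_b, fun x hx hvx => ?_⟩
      rcases ht.eq_of_adj v (by simp) x hx hvx with h3 | h3
      · exact absurd (h3.1.symm.trans h2.symm) hab
      · exact h3.2
  have hv'q : v' ≠ q := fun h => hv' (by simp [h])
  refine ⟨v', hv'q, ?_, h.eq_zero_of_not_supp fun hs => hv'q (hp.2 _ hs)⟩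
  ext x
  simp only [mem_neighborSet, Set.mem_insert_iff, Set.mem_singleton_iff]
  refine ⟨fun hx => ?_, ?_⟩
  · by_cases hxq : x = q
    · exact Or.inl hxq
    · exact Or.inr (hon x (by simp [hxq, hx.ne']) hx)
  · rintro (rfl | rfl)
    · exact hp.1.1
    · exact hadj

theorem Pendant.degN_eq_two {G : SimpleGraph V} {R : Finset V} (hG : Covered G R)
    {c : V → Bool} (hc : ∀ u v, G.Adj u v → c u ≠ c v) {z : Sym2 V → ℝ}
    {e : Sym2 V} (h : IsFacet G R z e) {v q : V} (hp : Pendant G z v q) : degN G v = 2 := by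
  obtain ⟨v', hne, hN, -⟩ := hp.exists_nbr hG hc h
  rw [degN, hN, Set.ncard_pair hne.symm]

/-- A vertex which is pendant for two facets without common zero has neighbours with the same
property. -/
theorem Pendant.swap {G : SimpleGraph V} {R : Finset V} (hG : Covered G R)
    {c : V → Bool} (hc : ∀ u v, G.Adj u v → c u ≠ c v) {z z' : Sym2 V → ℝ}
    {e e' : Sym2 V} (h : IsFacet G R z e) (h' : IsFacet G R z' e')
    (hdis : ∀ f ∈ G.edgeSet, z f = 0 → z' f ≠ 0) {v q q' : V} (hp : Pendant G z v q)
    (hp' : Pendant G z' v q') :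
    G.neighborSet v = {q, q'} ∧ ∃ r, Pendant G z' q r := by
  obtain ⟨x, hx, hN, hz⟩ := hp.exists_nbr hG hc h
  obtain ⟨x', hx', hN', hz'⟩ := hp'.exists_nbr hG hc h'
  have hxq' : x = q' := by
    have hvx : G.Adj v x := by
      have : x ∈ G.neighborSet v := by simp [hN]
      exact this
    exact hp'.2 x ⟨hvx, h'.pos (hdis _ hvx hz)⟩
  subst hxq'
  have hqx' : q = x' := by
    have : q ∈ G.neighborSet v := by simp [hN]
    rw [hN'] at this
    exact (by simpa using this : q = x ∨ q = x').resolve_left hx.symm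
  subst hqx'
  refine ⟨hN, ?_⟩
  have hq := hp.symm hG h
  obtain ⟨r, hr, hNq, hzr⟩ := hq.exists_nbr hG hc h
  have hqr : G.Adj q r := by
    have : r ∈ G.neighborSet q := by simp [hNq]
    exact this
  refine ⟨r, ⟨hqr, h'.pos (hdis _ hqr hzr)⟩, fun y hy => ?_⟩
  have : y ∈ G.neighborSet q := hy.1
  rw [hNq] at this
  rcases this with rfl | h1
  · exact absurd hy.2 (by rw [Sym2.eq_swap, hz']; exact lt_irrefl _)
  · exact h1

theorem Pendant.regular {G : SimpleGraph V} {R : Finset V} (hG : Covered G R)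
    {c : V → Bool} (hc : ∀ u v, G.Adj u v → c u ≠ c v) {z z' : Sym2 V → ℝ}
    {e e' : Sym2 V} (h : IsFacet G R z e) (h' : IsFacet G R z' e')
    (hdis : ∀ f ∈ G.edgeSet, z f = 0 → z' f ≠ 0) {v q q' : V} (hp : Pendant G z v q)
    (hp' : Pendant G z' v q') : ∀ u ∈ R, degN G u = 2 := by
  intro u hu
  have h1 := mem_of_reachable (S := {x | (∃ y, Pendant G z x y) ∧ ∃ y, Pendant G z' x y}) ?_
    (hG.conn v (hG.mem _ _ hp.1.1) u hu) ⟨⟨q, hp⟩, q', hp'⟩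
  · obtain ⟨⟨y, hy⟩, -⟩ := h1
    exact hy.degN_eq_two hG hc h
  · rintro a b ⟨⟨y, hy⟩, y', hy'⟩ hab
    obtain ⟨hN, r, hr⟩ := hy.swap hG hc h h' hdis hy'
    obtain ⟨-, r', hr'⟩ := hy'.swap hG hc h' h (fun f hf h0 h1 => hdis f hf h1 h0) hy
    have : b ∈ G.neighborSet a := hab
    rw [hN] at this
    rcases this with rfl | h1
    · exact ⟨⟨a, hy.symm hG h⟩, r, hr⟩
    · rw [Set.mem_singleton_iff.1 h1]
      exact ⟨⟨r', hr'⟩, a, hy'.symm hG h'⟩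

theorem hasTwoEdgeMatching_of_pendant {G : SimpleGraph V} {R : Finset V} (hG : Covered G R)
    {c : V → Bool} (hc : ∀ u v, G.Adj u v → c u ≠ c v) {I : Finset (Sym2 V)}
    (hI : G.edgeSet.ncard + 2 ≤ I.card + R.card) (z : Sym2 V → Sym2 V → ℝ)
    (hz : ∀ e ∈ I, IsFacet G R (z e) e ∧ ∀ e' ∈ I, e' ≠ e → 0 < z e e')
    (hp : ∀ e ∈ I, ∃ v q, Pendant G (z e) v q) :
    (∀ u ∈ R, degN G u = 2) ∨ HasTwoEdgeMatching G R := by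
  by_cases hreg : ∀ u ∈ R, degN G u = 2
  · exact Or.inl hreg
  right
  have hdis : ∀ e ∈ I, ∀ e' ∈ I, e ≠ e' → ∀ f ∈ G.edgeSet, z e f = 0 → z e' f ≠ 0 := by
    intro e he e' he' hne f hf h0
    obtain ⟨h1, h2⟩ := hz e' he'
    obtain ⟨k, hk, hkx⟩ := (hz e he).1.rigid f hf h0
    rw [hkx _ ⟨h1.off, 1, h1.sum_eq⟩]
    exact (mul_pos hk (h2 e he hne)).ne'
  have hshare : ∀ e ∈ I, ∀ e' ∈ I, e ≠ e' → ∀ v q q', Pendant G (z e) v q →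
      ¬ Pendant G (z e') v q' := fun e he e' he' hne v q q' h1 h2 =>
    hreg (h1.regular hG hc (hz e he).1 (hz e' he').1 (hdis e he e' he' hne) h2)
  have hnz : ∀ e ∈ I, ∀ e' ∈ I, e ≠ e' → ∀ u p u' p', Pendant G (z e) u p →
      Pendant G (z e') u' p' → G.Adj u u' → z e s(u, u') = 0 := by
    intro e he e' he' hne u p u' p' h1 h2 hadj
    refine (hz e he).1.eq_zero_of_not_supp fun hs => ?_
    obtain rfl := h1.2 _ hs
    exact hshare e he e' he' hne _ _ _ (h1.symm hG (hz e he).1) h2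
  have : Nonempty V := by
    obtain ⟨u, -⟩ := Finset.card_pos.1 (by have := hG.card; omega : 0 < R.card)
    exact ⟨u⟩
  choose! v q hvq using hp
  have hmem : ∀ e ∈ I, ∀ u ∈ s(v e, q e), ∃ p, Pendant G (z e) u p := by
    intro e he u hu
    rcases Sym2.mem_iff.1 hu with rfl | rfl
    · exact ⟨_, hvq e he⟩
    · exact ⟨_, (hvq e he).symm hG (hz e he).1⟩
  refine ⟨(fun e => s(v e, q e)) '' I, ⟨?_, ?_⟩, ?_, ?_⟩
  · rintro _ ⟨e, he, rfl⟩
    exact (hvq e he).1.1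
  · rintro _ ⟨e, he, rfl⟩ _ ⟨e', he', rfl⟩ hne u hu u' hu'
    have hne' : e ≠ e' := fun h => hne (by simp [h])
    obtain ⟨p, hp⟩ := hmem e he u hu
    obtain ⟨p', hp'⟩ := hmem e' he' u' hu'
    refine ⟨?_, fun hadj => ?_⟩
    · rintro rfl
      exact hshare e he e' he' hne' _ _ _ hp hp'
    · have h1 := hnz e he e' he' hne' _ _ _ _ hp hp' hadj
      have h2 := hnz e' he' e he hne'.symm _ _ _ _ hp' hp hadj.symm
      rw [Sym2.eq_swap] at h2
      exact hdis e he e' he' hne' _ hadj h1 h2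
  · rintro _ ⟨e, he, rfl⟩
    refine ⟨(hvq e he).1.1, fun u hu => ?_⟩
    obtain ⟨p, hp⟩ := hmem e he u hu
    exact hp.degN_eq_two hG hc (hz e he).1
  · rw [Set.InjOn.ncard_image, Set.ncard_coe_finset]
    · exact hI
    · intro e he e' he' heq
      by_contra hne
      obtain ⟨p, hp⟩ := hmem e he (v e) (Sym2.mem_mk_left _ _)
      obtain ⟨p', hp'⟩ := hmem e' he' (v e) (by
        simp only at heq
        rw [← heq]; exact Sym2.mem_mk_left _ _)
      exact hshare e he e' he' hne _ _ _ hp hp'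

theorem hasTwoEdgeMatching_of_regular {G : SimpleGraph V} {R : Finset V} (hG : Covered G R)
    (h6 : 6 ≤ R.card) (hreg : ∀ u ∈ R, degN G u = 2) : HasTwoEdgeMatching G R := by
  classical
  have hm : G.edgeSet.ncard = R.card := by
    have h1 := sum_degN hG.mem
    rw [Finset.sum_congr rfl hreg, Finset.sum_const, smul_eq_mul] at h1
    omega
  obtain ⟨u, hu⟩ : R.Nonempty := Finset.card_pos.1 (by omega)
  obtain ⟨v, huv⟩ := hG.exists_adj hu
  have hv := hG.mem _ _ huv.symm
  obtain ⟨u', hu'v, hNu⟩ := exists_eq_pair_of_degN (hreg u hu) huv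
  obtain ⟨v', hv'u, hNv⟩ := exists_eq_pair_of_degN (hreg v hv) huv.symm
  have hu' : ∀ x, G.Adj u x ↔ x = v ∨ x = u' := fun x => by
    rw [← mem_neighborSet, hNu]; simp
  have hv' : ∀ x, G.Adj v x ↔ x = u ∨ x = v' := fun x => by
    rw [← mem_neighborSet, hNv]; simp
  let B : Finset V := {u, v, u', v'}
  have hB : 2 ≤ (R \ B).card := by
    have h1 : B.card ≤ 4 := Finset.card_le_four
    have h2 := Finset.le_card_sdiff B R
    omega
  obtain ⟨w, hw, x, hwx, hxu, hxv⟩ : ∃ w ∈ R \ B, ∃ x, G.Adj w x ∧ x ≠ u' ∧ x ≠ v' := by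
    by_contra! hcon
    have key : ∀ w ∈ R \ B, G.Adj w u' := by
      intro w hw
      obtain ⟨x, y, hxy, hN⟩ := Set.ncard_eq_two.1 (hreg w (Finset.mem_sdiff.1 hw).1)
      by_contra hn
      have hx : G.Adj w x := by
        have : x ∈ G.neighborSet w := by simp [hN]
        exact this
      have hy : G.Adj w y := by
        have : y ∈ G.neighborSet w := by simp [hN]
        exact this
      have h1 := hcon w hw x hx fun h => hn (h ▸ hx)
      have h2 := hcon w hw y hy fun h => hn (h ▸ hy)
      exact hxy (h1.trans h2.symm)
    obtain ⟨w₁, h1, w₂, h2, hne⟩ := Finset.one_lt_card.1 hB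
    have hu'R := hG.mem _ _ ((hu' u').2 (Or.inr rfl)).symm
    have h3 : ({u, w₁, w₂} : Finset V).card = 3 := Finset.card_eq_three.2
      ⟨u, w₁, w₂, by rintro rfl; simp [B] at h1, by rintro rfl; simp [B] at h2, hne, rfl⟩
    have h4 : (({u, w₁, w₂} : Finset V) : Set V).ncard ≤ (G.neighborSet u').ncard := by
      refine Set.ncard_le_ncard ?_ (Set.toFinite _)
      intro y hy
      simp only [Finset.coe_insert, Finset.coe_singleton, Set.mem_insert_iff,
        Set.mem_singleton_iff] at hy
      rcases hy with rfl | rfl | rfl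
      · exact ((hu' u').2 (Or.inr rfl)).symm
      · exact (key _ h1).symm
      · exact (key _ h2).symm
    rw [Set.ncard_coe_finset, h3] at h4
    have := hreg u' hu'R
    rw [degN] at this
    omega
  have hwR := (Finset.mem_sdiff.1 hw).1
  have hxR := hG.mem _ _ hwx.symm
  have hwB : w ≠ u ∧ w ≠ v ∧ w ≠ u' ∧ w ≠ v' := by
    simpa [B] using (Finset.mem_sdiff.1 hw).2
  have hx' : x ≠ u ∧ x ≠ v := by
    constructor
    · rintro rfl
      rcases (hu' w).1 hwx.symm with h | h
      exacts [hwB.2.1 h, hwB.2.2.1 h]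
    · rintro rfl
      rcases (hv' w).1 hwx.symm with h | h
      exacts [hwB.1 h, hwB.2.2.2 h]
  have hfar : ∀ a ∈ s(u, v), ∀ b ∈ s(w, x), a ≠ b ∧ ¬ G.Adj a b := by
    intro a ha b hb
    rcases Sym2.mem_iff.1 ha with rfl | rfl <;> rcases Sym2.mem_iff.1 hb with rfl | rfl <;>
      simp only [hu', hv'] <;> tauto
  have hdist : s(u, v) ≠ s(w, x) := fun h =>
    (hfar u (Sym2.mem_mk_left _ _) u (h ▸ Sym2.mem_mk_left _ _)).1 rfl
  refine ⟨{s(u, v), s(w, x)}, ⟨?_, ?_⟩, ?_, ?_⟩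
  · rintro e (rfl | rfl)
    exacts [huv, hwx]
  · rintro e (rfl | rfl) f (rfl | rfl) hne a ha b hb
    · exact absurd rfl hne
    · exact hfar a ha b hb
    · exact ⟨(hfar b hb a ha).1.symm, fun h => (hfar b hb a ha).2 h.symm⟩
    · exact absurd rfl hne
  · rintro e (rfl | rfl)
    · refine ⟨huv, fun a ha => ?_⟩
      rcases Sym2.mem_iff.1 ha with rfl | rfl
      exacts [hreg _ hu, hreg _ hv]
    · refine ⟨hwx, fun a ha => ?_⟩
      rcases Sym2.mem_iff.1 ha with rfl | rfl
      exacts [hreg _ hwR, hreg _ hxR]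
  · rw [Set.ncard_pair hdist, hm]
    omega

end Pendant

section Splitting

/-- The graph of the edges of `G` meeting `S`, together with a new edge joining `a'` and `b'`. -/
def piece {V : Type*} (G : SimpleGraph V) (S : Finset V) (a' b' : V) : SimpleGraph V where
  Adj u v := (G.Adj u v ∧ (u ∈ S ∨ v ∈ S)) ∨ (s(u, v) = s(a', b') ∧ u ≠ v)
  symm := ⟨fun u v h => by
    rw [G.adj_comm, Sym2.eq_swap, ne_comm, or_comm (a := v ∈ S)]
    exact h⟩
  loopless := ⟨fun u h => by simp at h⟩

/-- The edges of `G` with both ends in `S`. -/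
def inner {V : Type*} (G : SimpleGraph V) (S : Finset V) : Set (Sym2 V) :=
  {e ∈ G.edgeSet | ∀ u ∈ e, u ∈ S}

theorem reachable_map {V W : Type*} {G : SimpleGraph V} {H : SimpleGraph W} (φ : V → W)
    (h : ∀ u v, G.Adj u v → H.Reachable (φ u) (φ v)) {u v : V} (huv : G.Reachable u v) :
    H.Reachable (φ u) (φ v) := by
  obtain ⟨p⟩ := huv
  induction p with
  | nil => exact Reachable.refl _
  | cons hadj p ih => exact (h _ _ hadj).trans ih

namespace IsTie

variable {V : Type*} [DecidableEq V] {c : V → Bool} {G : SimpleGraph V} {R S : Finset V}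
  {a a' b b' : V}

theorem a'_notMem (h : IsTie c G R S a a' b b') : a' ∉ S := (Finset.mem_sdiff.1 h.mem_a').2

theorem b'_notMem (h : IsTie c G R S a a' b b') : b' ∉ S := (Finset.mem_sdiff.1 h.mem_b').2

theorem ne (h : IsTie c G R S a a' b b') : a ≠ b := fun h' => h.color (by rw [h'])

theorem a_ne_b' (h : IsTie c G R S a a' b b') : a ≠ b' := fun h' => h.b'_notMem (h' ▸ h.mem_a)

theorem b_ne_a' (h : IsTie c G R S a a' b b') : b ≠ a' := fun h' => h.a'_notMem (h' ▸ h.mem_b)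

theorem color' (h : IsTie c G R S a a' b b') (hc : ∀ u v, G.Adj u v → c u ≠ c v) :
    c a' ≠ c b' := by
  have h1 := hc _ _ h.adj_a
  have h2 := hc _ _ h.adj_b
  have h3 := h.color
  revert h1 h2 h3
  cases c a <;> cases c a' <;> cases c b <;> cases c b' <;> simp

theorem ne' (h : IsTie c G R S a a' b b') (hc : ∀ u v, G.Adj u v → c u ≠ c v) : a' ≠ b' :=
  fun h' => h.color' hc (by rw [h'])

theorem piece_color (h : IsTie c G R S a a' b b') (hc : ∀ u v, G.Adj u v → c u ≠ c v) :
    ∀ u v, (piece G S a' b').Adj u v → c u ≠ c v := by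
  rintro u v (h1 | h1)
  · exact hc u v h1.1
  · have := h.color' hc
    rcases Sym2.eq_iff.1 h1.1 with ⟨rfl, rfl⟩ | ⟨rfl, rfl⟩
    · exact this
    · exact this.symm

theorem piece_adj_iff (h : IsTie c G R S a a' b b') {u v : V} (hu : u ∈ S) :
    (piece G S a' b').Adj u v ↔ G.Adj u v := by
  refine ⟨?_, fun huv => Or.inl ⟨huv, Or.inl hu⟩⟩
  rintro (h1 | ⟨h1, -⟩)
  · exact h1.1
  · rcases Sym2.eq_iff.1 h1 with ⟨rfl, -⟩ | ⟨rfl, -⟩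
    · exact absurd hu h.a'_notMem
    · exact absurd hu h.b'_notMem

theorem piece_adj_new (h : IsTie c G R S a a' b b') (hc : ∀ u v, G.Adj u v → c u ≠ c v) :
    (piece G S a' b').Adj a' b' := Or.inr ⟨rfl, h.ne' hc⟩

theorem eq_of_adj_a' (h : IsTie c G R S a a' b b') (hc : ∀ u v, G.Adj u v → c u ≠ c v) {x : V}
    (hx : (piece G S a' b').Adj a' x) : x = a ∨ x = b' := by
  rcases hx with ⟨h1, h2⟩ | ⟨h1, -⟩
  · rcases h.eq_of_adj x (h2.resolve_left h.a'_notMem) a' h.a'_notMem h1.symm with h3 | h3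
    · exact Or.inl h3.1
    · exact absurd h3.2 (h.ne' hc)
  · exact Or.inr (Sym2.congr_right.1 h1)

theorem eq_of_adj_b' (h : IsTie c G R S a a' b b') (hc : ∀ u v, G.Adj u v → c u ≠ c v) {x : V}
    (hx : (piece G S a' b').Adj b' x) : x = b ∨ x = a' := by
  rcases hx with ⟨h1, h2⟩ | ⟨h1, -⟩
  · rcases h.eq_of_adj x (h2.resolve_left h.b'_notMem) b' h.b'_notMem h1.symm with h3 | h3
    · exact absurd h3.2 (h.ne' hc).symm
    · exact Or.inl h3.1
  · rw [Sym2.eq_swap (a := a')] at h1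
    exact Or.inr (Sym2.congr_right.1 h1)

theorem piece_mem (h : IsTie c G R S a a' b b') {u v : V} (huv : (piece G S a' b').Adj u v) :
    u ∈ insert a' (insert b' S) := by
  simp only [Finset.mem_insert]
  rcases huv with ⟨h1, h2⟩ | ⟨h1, -⟩
  · by_cases hu : u ∈ S
    · exact Or.inr (Or.inr hu)
    · rcases h.eq_of_adj v (h2.resolve_left hu) u hu h1.symm with h3 | h3
      · exact Or.inl h3.2
      · exact Or.inr (Or.inl h3.2)
  · rcases Sym2.eq_iff.1 h1 with ⟨rfl, -⟩ | ⟨rfl, -⟩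
    · exact Or.inl rfl
    · exact Or.inr (Or.inl rfl)

theorem card_insert (h : IsTie c G R S a a' b b') (hc : ∀ u v, G.Adj u v → c u ≠ c v) :
    (insert a' (insert b' S)).card = S.card + 2 := by
  rw [Finset.card_insert_of_notMem (by simp [h.ne' hc, h.a'_notMem]),
    Finset.card_insert_of_notMem h.b'_notMem]

variable [Fintype V]

theorem weight_eq (h : IsTie c G R S a a' b b') (hc : ∀ u v, G.Adj u v → c u ≠ c v)
    {w : Sym2 V → ℝ} (hw : IsPosWeight G R w) : w s(a, a') = w s(b, b') := by
  have h1 := sum_cut hc hw.2.1 S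
  have h2 : ∑ u ∈ S, sgn c u * vsum w u = 0 := by
    rw [← h.sum_sgn]
    exact Finset.sum_congr rfl fun u hu => by rw [hw.2.2 u (h.subset hu), mul_one]
  rw [h2, Finset.sum_eq_add_of_mem a b h.mem_a h.mem_b h.ne] at h1
  · rw [Finset.sum_eq_single a', Finset.sum_eq_single b', sgn_eq_neg h.color] at h1
    · have h3 : sgn c b * (w s(b, b') - w s(a, a')) = 0 := by linarith
      linarith [(mul_eq_zero.1 h3).resolve_left (sgn_ne_zero c b)]
    · intro v hv hne
      refine weight_eq_zero hw.2.1 fun hadj => ?_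
      rcases h.eq_of_adj b h.mem_b v (Finset.mem_compl.1 hv) hadj with h3 | h3
      exacts [h.ne h3.1.symm, hne h3.2]
    · exact fun hn => absurd (Finset.mem_compl.2 h.b'_notMem) hn
    · intro v hv hne
      refine weight_eq_zero hw.2.1 fun hadj => ?_
      rcases h.eq_of_adj a h.mem_a v (Finset.mem_compl.1 hv) hadj with h3 | h3
      exacts [hne h3.2, h.ne h3.1]
    · exact fun hn => absurd (Finset.mem_compl.2 h.a'_notMem) hn
  · rintro u hu ⟨hua, hub⟩
    rw [Finset.sum_eq_zero, mul_zero]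
    intro v hv
    refine weight_eq_zero hw.2.1 fun hadj => ?_
    rcases h.eq_of_adj u hu v (Finset.mem_compl.1 hv) hadj with h3 | h3
    exacts [hua h3.1, hub h3.1]

theorem covered_piece (h : IsTie c G R S a a' b b') (hc : ∀ u v, G.Adj u v → c u ≠ c v)
    (hG : Covered G R) : Covered (piece G S a' b') (insert a' (insert b' S)) := by
  have hab' := h.piece_adj_new hc
  refine ⟨fun u v => h.piece_mem, ?_, ?_, ?_⟩
  · have hφ : ∀ {u v}, G.Reachable u v → (piece G S a' b').Reachable
        (if u ∈ S then u else a') (if v ∈ S then v else a') := by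
      intro u v huv
      have key : ∀ u ∈ S, ∀ v ∉ S, G.Adj u v → (piece G S a' b').Reachable u a' := by
        intro u hu v hv huv
        have h1 := ((h.piece_adj_iff hu).2 huv).reachable
        rcases h.eq_of_adj u hu v hv huv with ⟨-, rfl⟩ | ⟨-, rfl⟩
        · exact h1
        · exact h1.trans hab'.symm.reachable
      refine reachable_map (fun u => if u ∈ S then u else a') (fun u v huv => ?_) huv
      by_cases hu : u ∈ S <;> by_cases hv : v ∈ S <;> simp only [hu, hv, if_true, if_false]
      · exact ((h.piece_adj_iff hu).2 huv).reachable
      · exact key u hu v hv huv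
      · exact (key v hv u hu huv.symm).symm
      · exact Reachable.refl _
    have key : ∀ u ∈ insert a' (insert b' S), (piece G S a' b').Reachable a' u := by
      intro u hu
      rcases Finset.mem_insert.1 hu with rfl | hu
      · exact Reachable.refl _
      rcases Finset.mem_insert.1 hu with rfl | hu
      · exact hab'.reachable
      have := hφ (hG.conn a' (Finset.sdiff_subset h.mem_a') u (h.subset hu))
      simpa only [h.a'_notMem, hu, if_true, if_false] using this
    exact fun u hu v hv => (key u hu).symm.trans (key v hv)
  · rw [h.card_insert hc]
    have := Finset.one_lt_card.2 ⟨a, h.mem_a, b, h.mem_b, h.ne⟩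
    omega
  · obtain ⟨w, hw⟩ := hG.weight
    classical
    let w₁ : Sym2 V → ℝ := fun e =>
      if e = s(a', b') then 1 - w s(a, a') else if ∃ u ∈ e, u ∈ S then w e else 0
    have hnew : w₁ s(a', b') = 1 - w s(a, a') := by simp [w₁]
    have hS : ∀ u ∈ S, ∀ v, w₁ s(u, v) = w s(u, v) := by
      intro u hu v
      have h1 : s(u, v) ≠ s(a', b') := by
        intro heq
        rcases Sym2.eq_iff.1 heq with ⟨rfl, -⟩ | ⟨rfl, -⟩
        exacts [h.a'_notMem hu, h.b'_notMem hu]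
      have h2 : ∃ x ∈ s(u, v), x ∈ S := ⟨u, Sym2.mem_mk_left _ _, hu⟩
      simp only [w₁, if_neg h1, if_pos h2]
    have hoff : ∀ e ∉ (piece G S a' b').edgeSet, w₁ e = 0 := by
      intro e he
      have h1 : e ≠ s(a', b') := by rintro rfl; exact he hab'
      by_cases h2 : ∃ u ∈ e, u ∈ S
      · simp only [w₁, if_neg h1, if_pos h2]
        obtain ⟨u, hu, huS⟩ := h2
        refine hw.2.1 e fun heG => he ?_
        obtain ⟨v, rfl⟩ := Sym2.mem_iff_exists.1 hu
        exact (h.piece_adj_iff huS).2 heG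
      · simp only [w₁, if_neg h1, if_neg h2]
    refine ⟨w₁, fun e he => ?_, hoff, fun u hu => ?_⟩
    · by_cases h1 : e = s(a', b')
      · rw [h1, hnew]
        linarith [hw.lt_one hG h.adj_a]
      · induction e with | _ u v => ?_
        rcases he with ⟨h2, h3 | h3⟩ | h2
        · rw [hS u h3]; exact hw.1 _ h2
        · rw [Sym2.eq_swap, hS v h3]; exact hw.1 _ h2.symm
        · exact absurd h2.1 h1
    · rcases Finset.mem_insert.1 hu with rfl | hu
      · rw [vsum_eq_pair (p := a) (q := b') h.a_ne_b', hnew,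
          Sym2.eq_swap, hS a h.mem_a]
        · ring
        · intro v hva hvb
          exact weight_eq_zero hoff fun hadj => (h.eq_of_adj_a' hc hadj).elim hva hvb
      rcases Finset.mem_insert.1 hu with rfl | hu
      · rw [vsum_eq_pair (p := b) (q := a') h.b_ne_a',
          Sym2.eq_swap, hS b h.mem_b, Sym2.eq_swap (a := u), hnew, h.weight_eq hc hw]
        · ring
        · intro v hva hvb
          exact weight_eq_zero hoff fun hadj => (h.eq_of_adj_b' hc hadj).elim hva hvb
      · rw [vsum_congr (hS u hu)]
        exact hw.2.2 u (h.subset hu)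

/-- An edge that can be removed from a piece can be removed from the whole graph. -/
theorem covered_deleteEdges (h : IsTie c G R S a a' b b') (hc : ∀ u v, G.Adj u v → c u ≠ c v)
    (hG : Covered G R) {e : Sym2 V} (he : e ∈ (piece G S a' b').edgeSet)
    (hK : Covered ((piece G S a' b').deleteEdges {e}) (insert a' (insert b' S))) :
    e ∈ G.edgeSet ∧ Covered (G.deleteEdges {e}) R := by
  set K := (piece G S a' b').deleteEdges {e} with hKdef
  have hKadj : ∀ u v, K.Adj u v ↔ (piece G S a' b').Adj u v ∧ s(u, v) ≠ e := fun u v => by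
    simp [hKdef]
  have hGadj : ∀ u v, (G.deleteEdges {e}).Adj u v ↔ G.Adj u v ∧ s(u, v) ≠ e := fun u v => by
    simp
  obtain ⟨ha'a, ha'b'⟩ : K.Adj a' a ∧ K.Adj a' b' := by
    obtain ⟨x, hx⟩ := hK.exists_adj (u := a') (by simp)
    obtain ⟨y, hne, hy⟩ := hK.exists_adj_ne hx
    rcases h.eq_of_adj_a' hc ((hKadj _ _).1 hx).1 with rfl | rfl <;>
    rcases h.eq_of_adj_a' hc ((hKadj _ _).1 hy).1 with rfl | rfl
    · exact absurd rfl hne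
    · exact ⟨hx, hy⟩
    · exact ⟨hy, hx⟩
    · exact absurd rfl hne
  have hb'b : K.Adj b' b := by
    obtain ⟨y, hne, hy⟩ := hK.exists_adj_ne ha'b'.symm
    rcases h.eq_of_adj_b' hc ((hKadj _ _).1 hy).1 with rfl | rfl
    · exact hy
    · exact absurd rfl hne
  have heS : ∀ u ∈ e, u ∈ S := by
    intro u hu
    obtain ⟨v, rfl⟩ := Sym2.mem_iff_exists.1 hu
    by_contra huS
    have hadj : (piece G S a' b').Adj u v := he
    have hm := h.piece_mem hadj
    simp only [Finset.mem_insert, huS, or_false] at hm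
    rcases hm with rfl | rfl
    · rcases h.eq_of_adj_a' hc hadj with rfl | rfl
      exacts [((hKadj _ _).1 ha'a).2 rfl, ((hKadj _ _).1 ha'b').2 rfl]
    · rcases h.eq_of_adj_b' hc hadj with rfl | rfl
      exacts [((hKadj _ _).1 hb'b).2 rfl, ((hKadj _ _).1 ha'b'.symm).2 rfl]
  have heG : e ∈ G.edgeSet := by
    induction e with | _ p q => ?_
    exact (h.piece_adj_iff (heS p (Sym2.mem_mk_left _ _))).1 he
  have hKG : ∀ u ∈ S, ∀ v, K.Adj u v ↔ (G.deleteEdges {e}).Adj u v := fun u hu v => by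
    rw [hKadj, hGadj, h.piece_adj_iff hu]
  have hout : ∀ u v, u ∉ S → G.Adj u v → (G.deleteEdges {e}).Adj u v := fun u v hu huv =>
    (hGadj _ _).2 ⟨huv, fun heq => hu (heS u (heq ▸ Sym2.mem_mk_left _ _))⟩
  have hwithin : within G (R \ S) ≤ G.deleteEdges {e} := fun u v huv =>
    hout u v (Finset.mem_sdiff.1 huv.2.1).2 huv.1
  refine ⟨heG, fun u v huv => hG.mem u v (deleteEdges_le _ huv), ?_, hG.card, ?_⟩
  · have hstep : ∀ u v, K.Adj u v → (G.deleteEdges {e}).Reachable u v := by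
      intro u v huv
      by_cases hu : u ∈ S
      · exact ((hKG u hu v).1 huv).reachable
      by_cases hv : v ∈ S
      · exact ((hKG v hv u).1 huv.symm).symm.reachable
      have h1 := (((hKadj _ _).1 huv).1.resolve_left fun h1 => h1.2.elim hu hv).1
      have h2 := (h.conn_compl a' h.mem_a' b' h.mem_b').mono hwithin
      rcases Sym2.eq_iff.1 h1 with ⟨rfl, rfl⟩ | ⟨rfl, rfl⟩
      exacts [h2, h2.symm]
    have key : ∀ u ∈ R, (G.deleteEdges {e}).Reachable a' u := by
      intro u hu
      by_cases huS : u ∈ S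
      · exact reachable_map id hstep (hK.conn a' (by simp) u (by simp [huS]))
      · exact (h.conn_compl a' h.mem_a' u (Finset.mem_sdiff.2 ⟨hu, huS⟩)).mono hwithin
    exact fun u hu v hv => (key u hu).symm.trans (key v hv)
  · obtain ⟨w, hw⟩ := hK.weight
    obtain ⟨x, hx, hxt⟩ := hG.exists_weight_eq hc h.adj_a (hw.1 s(a, a') ha'a.symm)
      (hw.lt_one hK ha'a.symm)
    have hwa : w s(a', a) + w s(a', b') = 1 := by
      rw [← hw.2.2 a' (by simp), vsum_eq_pair h.a_ne_b']
      intro v hva hvb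
      exact weight_eq_zero hw.2.1 fun hadj =>
        (h.eq_of_adj_a' hc ((hKadj _ _).1 hadj).1).elim hva hvb
    have hwb : w s(b', b) + w s(b', a') = 1 := by
      rw [← hw.2.2 b' (by simp), vsum_eq_pair h.b_ne_a']
      intro v hva hvb
      exact weight_eq_zero hw.2.1 fun hadj =>
        (h.eq_of_adj_b' hc ((hKadj _ _).1 hadj).1).elim hva hvb
    have hxb : x s(b, b') = w s(b, b') := by
      rw [← h.weight_eq hc hx, hxt, Sym2.eq_swap, Sym2.eq_swap (a := b)]
      rw [Sym2.eq_swap (a := b') (b := a')] at hwb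
      linarith
    have hcut : ∀ u ∈ S, ∀ v ∉ S, w s(u, v) = x s(u, v) := by
      intro u hu v hv
      by_cases hadj : G.Adj u v
      · rcases h.eq_of_adj u hu v hv hadj with ⟨rfl, rfl⟩ | ⟨rfl, rfl⟩
        exacts [hxt.symm, hxb.symm]
      · rw [weight_eq_zero hx.2.1 hadj, weight_eq_zero hw.2.1 fun hk =>
          hadj ((hGadj _ _).1 ((hKG u hu v).1 hk)).1]
    classical
    let W : Sym2 V → ℝ := fun f => if ∃ u ∈ f, u ∈ S then w f else x f
    have hWS : ∀ u ∈ S, ∀ v, W s(u, v) = w s(u, v) := fun u hu v =>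
      if_pos ⟨u, Sym2.mem_mk_left _ _, hu⟩
    have hWT : ∀ u ∉ S, ∀ v, W s(u, v) = x s(u, v) := by
      intro u hu v
      by_cases hv : v ∈ S
      · rw [Sym2.eq_swap, hWS v hv, hcut v hv u hu]
      · refine if_neg ?_
        rintro ⟨p, hp, hpS⟩
        rcases Sym2.mem_iff.1 hp with rfl | rfl
        exacts [hu hpS, hv hpS]
    refine ⟨W, fun f hf => ?_, fun f hf => ?_, fun u hu => ?_⟩
    · induction f with | _ u v => ?_
      by_cases huS : u ∈ S
      · rw [hWS u huS]
        exact hw.1 _ ((hKG u huS v).2 hf)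
      · rw [hWT u huS]
        exact hx.1 _ (deleteEdges_le _ hf)
    · induction f with | _ u v => ?_
      by_cases huS : u ∈ S
      · rw [hWS u huS]
        exact weight_eq_zero hw.2.1 fun hk => hf ((hKG u huS v).1 hk)
      · rw [hWT u huS]
        exact weight_eq_zero hx.2.1 fun hk => hf (hout u v huS hk)
    · by_cases huS : u ∈ S
      · rw [vsum_congr (hWS u huS)]
        exact hw.2.2 u (by simp [huS])
      · rw [vsum_congr (hWT u huS)]
        exact hx.2.2 u hu

theorem minCovered_piece (h : IsTie c G R S a a' b b') (hc : ∀ u v, G.Adj u v → c u ≠ c v)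
    (hG : MinCovered G R) : MinCovered (piece G S a' b') (insert a' (insert b' S)) :=
  ⟨h.covered_piece hc hG.1, fun _ he hK =>
    have h1 := h.covered_deleteEdges hc hG.1 he hK
    hG.2 _ h1.1 h1.2⟩

/-- Restricting a matching of a piece to its inner edges. -/
theorem exists_inner_matching (h : IsTie c G R S a a' b b')
    (hc : ∀ u v, G.Adj u v → c u ≠ c v)
    (hF : HasTwoEdgeMatching (piece G S a' b') (insert a' (insert b' S))) :
    ∃ F ⊆ inner G S, IsInducedMatching G F ∧ (∀ e ∈ F, IsTwoEdge G e) ∧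
      (inner G S).ncard + 2 ≤ F.ncard + S.card := by
  obtain ⟨F, ⟨hFE, hFi⟩, hF2, hcard⟩ := hF
  have hab' := h.piece_adj_new hc
  have hN : ∀ u ∈ S, (piece G S a' b').neighborSet u = G.neighborSet u := fun u hu =>
    Set.ext fun v => h.piece_adj_iff hu
  have hinner : ∀ e ∈ (piece G S a' b').edgeSet, (∀ u ∈ e, u ∈ S) → e ∈ inner G S := by
    intro e he heS
    refine ⟨?_, heS⟩
    induction e with | _ u v => ?_
    exact (h.piece_adj_iff (heS u (Sym2.mem_mk_left _ _))).1 he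
  let F₀ : Set (Sym2 V) := {e ∈ F | ∀ u ∈ e, u ∈ S}
  have hF₀ : F.ncard ≤ F₀.ncard + 1 := by
    have h1 : (F \ F₀).ncard ≤ 1 := by
      rw [Set.ncard_le_one]
      have key : ∀ e ∈ F \ F₀, ∃ u ∈ e, u = a' ∨ u = b' := by
        rintro e ⟨he, he0⟩
        have : ∃ u ∈ e, u ∉ S := by
          by_contra! hcon
          exact he0 ⟨he, hcon⟩
        obtain ⟨u, hu, huS⟩ := this
        obtain ⟨v, rfl⟩ := Sym2.mem_iff_exists.1 hu
        have := h.piece_mem (hFE he)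
        simp only [Finset.mem_insert, huS, or_false] at this
        exact ⟨u, hu, this⟩
      intro e he f hf
      by_contra hne
      obtain ⟨u, hu, hu'⟩ := key e he
      obtain ⟨v, hv, hv'⟩ := key f hf
      obtain ⟨h1, h2⟩ := hFi e he.1 f hf.1 hne u hu v hv
      rcases hu' with rfl | rfl <;> rcases hv' with rfl | rfl
      exacts [h1 rfl, h2 hab', h2 hab'.symm, h1 rfl]
    have h2 := Set.ncard_le_ncard_sdiff_add_ncard F F₀ (Set.toFinite _)
    omega
  have hm : (inner G S).ncard + 3 ≤ (piece G S a' b').edgeSet.ncard := by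
    have h1 : ∀ {u v : V}, u ∉ S → s(u, v) ∉ inner G S := fun hu hin =>
      hu (hin.2 _ (Sym2.mem_mk_left _ _))
    have hne := h.ne' hc
    have hab := h.a_ne_b'
    have hba := h.b_ne_a'
    have h3 : ({s(a', a), s(b', b), s(a', b')} : Set (Sym2 V)).ncard = 3 := by
      rw [Set.ncard_eq_three]
      refine ⟨_, _, _, ?_, ?_, ?_, rfl⟩ <;> simp [hne, hab, hba.symm, hba, hne.symm]
    have h4 : Disjoint (inner G S) {s(a', a), s(b', b), s(a', b')} := by
      rw [Set.disjoint_right]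
      rintro e (rfl | rfl | rfl)
      exacts [h1 h.a'_notMem, h1 h.b'_notMem, h1 h.a'_notMem]
    rw [← h3, ← Set.ncard_union_eq h4 (Set.toFinite _) (Set.toFinite _)]
    refine Set.ncard_le_ncard ?_ (Set.toFinite _)
    rintro e (he | rfl | rfl | rfl)
    · induction e with | _ u v => ?_
      exact (h.piece_adj_iff (he.2 u (Sym2.mem_mk_left _ _))).2 he.1
    · exact ((h.piece_adj_iff h.mem_a).2 h.adj_a).symm
    · exact ((h.piece_adj_iff h.mem_b).2 h.adj_b).symm
    · exact hab'
  refine ⟨F₀, fun e he => hinner e (hFE he.1) he.2, ⟨fun e he => (hinner e (hFE he.1) he.2).1,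
    fun e he f hf hne u hu v hv => ?_⟩, fun e he => ⟨(hinner e (hFE he.1) he.2).1,
    fun u hu => ?_⟩, ?_⟩
  · obtain ⟨h1, h2⟩ := hFi e he.1 f hf.1 hne u hu v hv
    exact ⟨h1, fun hadj => h2 ((h.piece_adj_iff (he.2 u hu)).2 hadj)⟩
  · have := (hF2 e he.1).2 u hu
    rwa [degN, hN u (he.2 u hu)] at this
  · rw [h.card_insert hc] at hcard
    omega

theorem edgeSet_ncard_le (h : IsTie c G R S a a' b b') (hR : ∀ u v, G.Adj u v → u ∈ R) :
    G.edgeSet.ncard ≤ (inner G S).ncard + (inner G (R \ S)).ncard + 2 := by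
  have h1 : G.edgeSet ⊆ inner G S ∪ inner G (R \ S) ∪ {s(a, a'), s(b, b')} := by
    intro e he
    induction e with | _ u v => ?_
    have huv : G.Adj u v := he
    have hmem : ∀ x y, G.Adj x y → x ∉ S → x ∈ R \ S := fun x y hxy hx =>
      Finset.mem_sdiff.2 ⟨hR x y hxy, hx⟩
    by_cases hu : u ∈ S <;> by_cases hv : v ∈ S
    · refine Or.inl (Or.inl ⟨he, fun x hx => ?_⟩)
      rcases Sym2.mem_iff.1 hx with rfl | rfl <;> assumption
    · right
      rcases h.eq_of_adj u hu v hv huv with ⟨rfl, rfl⟩ | ⟨rfl, rfl⟩ <;> simp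
    · right
      rw [Sym2.eq_swap]
      rcases h.eq_of_adj v hv u hu huv.symm with ⟨rfl, rfl⟩ | ⟨rfl, rfl⟩ <;> simp
    · refine Or.inl (Or.inr ⟨he, fun x hx => ?_⟩)
      rcases Sym2.mem_iff.1 hx with rfl | rfl
      exacts [hmem _ _ huv hu, hmem _ _ huv.symm hv]
  have h2 := Set.ncard_le_ncard h1 (Set.toFinite _)
  have h3 := Set.ncard_union_le (inner G S ∪ inner G (R \ S)) {s(a, a'), s(b, b')}
  have h4 := Set.ncard_union_le (inner G S) (inner G (R \ S))
  have h5 : ({s(a, a'), s(b, b')} : Set (Sym2 V)).ncard ≤ 2 :=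
    (Set.ncard_insert_le _ _).trans (by rw [Set.ncard_singleton])
  omega

/-- Matchings of the two pieces combine when the ends of the tie in `S` have degree at least
three. -/
theorem hasTwoEdgeMatching (h : IsTie c G R S a a' b b') (hc : ∀ u v, G.Adj u v → c u ≠ c v)
    (hR : ∀ u v, G.Adj u v → u ∈ R) (ha : degN G a ≠ 2) (hb : degN G b ≠ 2)
    (h₁ : HasTwoEdgeMatching (piece G S a' b') (insert a' (insert b' S)))
    (h₂ : HasTwoEdgeMatching (piece G (R \ S) a b) (insert a (insert b (R \ S)))) :
    HasTwoEdgeMatching G R := by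
  obtain ⟨F₁, hin₁, hind₁, htwo₁, hcard₁⟩ := h.exists_inner_matching hc h₁
  obtain ⟨F₂, hin₂, hind₂, htwo₂, hcard₂⟩ := (h.symm hc hR).exists_inner_matching hc h₂
  have hcross : ∀ e ∈ F₁, ∀ f ∈ F₂, ∀ u ∈ e, ∀ v ∈ f, u ≠ v ∧ ¬ G.Adj u v := by
    intro e he f hf u hu v hv
    have huS := (hin₁ he).2 u hu
    have hvS := (Finset.mem_sdiff.1 ((hin₂ hf).2 v hv)).2
    refine ⟨fun h' => hvS (h' ▸ huS), fun hadj => ?_⟩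
    have h1 := (htwo₁ e he).2 u hu
    rcases h.eq_of_adj u huS v hvS hadj with ⟨rfl, -⟩ | ⟨rfl, -⟩
    exacts [ha h1, hb h1]
  refine ⟨F₁ ∪ F₂, ⟨Set.union_subset hind₁.1 hind₂.1, ?_⟩, ?_, ?_⟩
  · rintro e (he | he) f (hf | hf) hne u hu v hv
    · exact hind₁.2 e he f hf hne u hu v hv
    · exact hcross e he f hf u hu v hv
    · have := hcross f hf e he v hv u hu
      exact ⟨this.1.symm, fun h' => this.2 h'.symm⟩
    · exact hind₂.2 e he f hf hne u hu v hv
  · rintro e (he | he)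
    exacts [htwo₁ e he, htwo₂ e he]
  · have hdisj : Disjoint F₁ F₂ := by
      rw [Set.disjoint_left]
      intro e he hf
      induction e with | _ u v => ?_
      exact (hcross _ he _ hf u (Sym2.mem_mk_left _ _) u (Sym2.mem_mk_left _ _)).1 rfl
    rw [Set.ncard_union_eq hdisj (Set.toFinite _) (Set.toFinite _)]
    have h1 := h.edgeSet_ncard_le hR
    have h2 := Finset.card_sdiff_add_card_eq_card h.subset
    omega

end IsTie

end Splitting

section Main

variable {V : Type*} [Fintype V]

theorem IsFacet.exists_supp_adj {G : SimpleGraph V} {R : Finset V} {z : Sym2 V → ℝ} {e : Sym2 V}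
    (h : IsFacet G R z e) {u : V} (hu : u ∈ R) : ∃ v, (supp G z).Adj u v := by
  by_contra! hcon
  have h0 : ∀ v, z s(u, v) = 0 := fun v => h.eq_zero_of_not_supp (hcon v)
  simpa [vsum, h0] using h.sum_eq u hu

/-- Without pendant vertices, every vertex has two neighbours along positive edges. -/
theorem IsFacet.exists_two_supp_adj {G : SimpleGraph V} {R : Finset V} {z : Sym2 V → ℝ}
    {e : Sym2 V} (h : IsFacet G R z e) (hp : ∀ v q, ¬ Pendant G z v q) {u : V} (hu : u ∈ R) :
    ∃ p q, p ≠ q ∧ (supp G z).Adj u p ∧ (supp G z).Adj u q := by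
  obtain ⟨p, hup⟩ := h.exists_supp_adj hu
  by_contra! hcon
  exact hp u p ⟨hup, fun q hq => by_contra fun hne => hcon p q (Ne.symm hne) hup hq⟩

theorem IsFacet.four_le_card {G : SimpleGraph V} {R : Finset V} {c : V → Bool}
    (hc : ∀ u v, G.Adj u v → c u ≠ c v) {z : Sym2 V → ℝ} {e : Sym2 V} (h : IsFacet G R z e)
    (hp : ∀ v q, ¬ Pendant G z v q) {T : Finset V} (hT : T ⊆ R) (hne : T.Nonempty)
    (hcl : ∀ u ∈ T, ∀ v, (supp G z).Adj u v → v ∈ T) : 4 ≤ T.card := by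
  classical
  obtain ⟨u, hu⟩ := hne
  obtain ⟨p, q, hpq, hup, huq⟩ := h.exists_two_supp_adj hp (hT hu)
  have hpT := hcl u hu p hup
  obtain ⟨x, y, hxy, hpx, hpy⟩ := h.exists_two_supp_adj hp (hT hpT)
  obtain ⟨v, hvu, hpv⟩ : ∃ v, v ≠ u ∧ (supp G z).Adj p v := by
    by_cases hx : x = u
    · exact ⟨y, fun hy => hxy (hx.trans hy.symm), hpy⟩
    · exact ⟨x, hx, hpx⟩
  have hvq : v ≠ q := by
    rintro rfl
    have h1 := hc _ _ hup.1
    have h2 := hc _ _ huq.1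
    have h3 := hc _ _ hpv.1
    revert h1 h2 h3
    cases c u <;> cases c p <;> cases c v <;> simp
  have h1 : ({u, p, q, v} : Finset V).card = 4 := by
    rw [Finset.card_insert_of_notMem, Finset.card_eq_three.2 ⟨p, q, v, hpq, hpv.ne, hvq.symm, rfl⟩]
    simp [hup.ne, huq.ne, hvu.symm]
  rw [← h1]
  refine Finset.card_le_card ?_
  simp [Finset.insert_subset_iff, hu, hpT, hcl u hu q huq, hcl p hpT v hpv]

theorem IsFacet.degN_ne_two {G : SimpleGraph V} {R : Finset V} {z : Sym2 V → ℝ}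
    {e : Sym2 V} (h : IsFacet G R z e) (hp : ∀ v q, ¬ Pendant G z v q) {u v : V} (hu : u ∈ R)
    (huv : G.Adj u v) (hv : ¬ (supp G z).Adj u v) : degN G u ≠ 2 := by
  classical
  obtain ⟨p, q, hpq, hup, huq⟩ := h.exists_two_supp_adj hp hu
  have h1 : ({v, p, q} : Finset V).card = 3 := Finset.card_eq_three.2
    ⟨v, p, q, by rintro rfl; exact hv hup, by rintro rfl; exact hv huq, hpq, rfl⟩
  have h2 : (({v, p, q} : Finset V) : Set V).ncard ≤ (G.neighborSet u).ncard := by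
    refine Set.ncard_le_ncard ?_ (Set.toFinite _)
    simp [Set.insert_subset_iff, huv, hup.1, huq.1]
  rw [Set.ncard_coe_finset, h1] at h2
  rw [degN]
  omega

theorem MinCovered.hasTwoEdgeMatching {c : V → Bool} {G : SimpleGraph V} {R : Finset V}
    (hc : ∀ u v, G.Adj u v → c u ≠ c v) (hG : MinCovered G R) (h6 : 6 ≤ R.card) :
    HasTwoEdgeMatching G R := by
  classical
  induction hn : R.card using Nat.strong_induction_on generalizing G R with
  | _ n ih =>
    obtain ⟨I, hI, hz⟩ := hG.1.exists_isFacet hc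
    choose! z hz using hz
    by_cases hp : ∀ e ∈ I, ∃ v q, Pendant G (z e) v q
    · rcases hasTwoEdgeMatching_of_pendant hG.1 hc hI z hz hp with hreg | h
      · exact hasTwoEdgeMatching_of_regular hG.1 h6 hreg
      · exact h
    push Not at hp
    obtain ⟨e, he, hp⟩ := hp
    have hF := (hz e he).1
    obtain ⟨s, hs, t, ht, hst⟩ := hF.exists_not_reachable hc hG
    let S := R.filter fun v => (supp G (z e)).Reachable s v
    have hmem : ∀ v, v ∈ S ↔ v ∈ R ∧ (supp G (z e)).Reachable s v := by simp [S]
    have hSR : S ⊆ R := Finset.filter_subset _ _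
    have hsS : s ∈ S := (hmem s).2 ⟨hs, Reachable.refl _⟩
    have htS : t ∉ S := fun h => hst ((hmem t).1 h).2
    have hcl : ∀ u ∈ S, ∀ v, (supp G (z e)).Adj u v → v ∈ S := fun u hu v huv =>
      (hmem v).2 ⟨hG.1.mem _ _ huv.1.symm, ((hmem u).1 hu).2.trans huv.reachable⟩
    have hcl' : ∀ u ∈ R \ S, ∀ v, (supp G (z e)).Adj u v → v ∈ R \ S := fun u hu v huv =>
      Finset.mem_sdiff.2 ⟨hG.1.mem _ _ huv.1.symm, fun hv =>
        (Finset.mem_sdiff.1 hu).2 (hcl v hv u huv.symm)⟩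
    obtain ⟨a, a', b, b', htie⟩ := hF.exists_isTie hc hG.1 hSR ⟨s, hsS⟩
      (fun h => htS (h ▸ ht)) hcl fun u hu v hv =>
        ((hmem u).1 hu).2.symm.trans ((hmem v).1 hv).2
    have htie' := htie.symm hc hG.1.mem
    have h4 := hF.four_le_card hc hp hSR ⟨s, hsS⟩ hcl
    have h4' := hF.four_le_card hc hp Finset.sdiff_subset ⟨t, Finset.mem_sdiff.2 ⟨ht, htS⟩⟩ hcl'
    have hsum := Finset.card_sdiff_add_card_eq_card hSR
    have hcard := htie.card_insert hc
    have hcard' := htie'.card_insert hc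
    refine htie.hasTwoEdgeMatching hc hG.1.mem
      (hF.degN_ne_two hp (hSR htie.mem_a) htie.adj_a fun h => htie.a'_notMem (hcl _ htie.mem_a _ h))
      (hF.degN_ne_two hp (hSR htie.mem_b) htie.adj_b fun h => htie.b'_notMem (hcl _ htie.mem_b _ h))
      (ih _ ?_ (htie.piece_color hc) (htie.minCovered_piece hc hG) ?_ rfl)
      (ih _ ?_ (htie'.piece_color hc) (htie'.minCovered_piece hc hG) ?_ rfl)
    all_goals omega

end Main

section MatchingCovered

variable {V : Type*} [Fintype V]

theorem MatchingCovered.covered {G : SimpleGraph V} (h : MatchingCovered G) :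
    Covered G Finset.univ := by
  classical
  obtain ⟨hconn, hcard, hM⟩ := h
  choose! M hM using hM
  let x : Sym2 V → Sym2 V → ℝ := fun e f => if f ∈ (M e).edgeSet then 1 else 0
  have hx : ∀ e ∈ G.edgeSet, ∀ u, vsum (x e) u = 1 := by
    intro e he u
    obtain ⟨v, hv, huniq⟩ := Subgraph.isPerfectMatching_iff.1 (hM e he).1 u
    rw [vsum_eq_single (q := v)]
    · exact if_pos hv
    · exact fun y hy => if_neg fun h => hy (huniq y h)
  have hx0 : ∀ e f, 0 ≤ x e f := fun e f => by simp only [x]; split_ifs <;> norm_num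
  have hmpos : (0 : ℝ) < G.edgeFinset.card := by
    have : Nontrivial V := Fintype.one_lt_card_iff_nontrivial.1 (by omega)
    obtain ⟨u⟩ := hconn.nonempty
    obtain ⟨v, hv⟩ := hconn.preconnected.exists_adj_of_nontrivial u
    exact_mod_cast Finset.card_pos.2 ⟨s(u, v), by simpa using hv⟩
  refine ⟨fun _ _ _ => Finset.mem_univ _, fun u _ v _ => hconn u v, by simpa using hcard,
    (G.edgeFinset.card : ℝ)⁻¹ • ∑ e ∈ G.edgeFinset, x e, fun f hf => ?_, fun f hf => ?_,
    fun u _ => ?_⟩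
  · rw [Pi.smul_apply, smul_eq_mul, Finset.sum_apply]
    refine mul_pos (inv_pos.2 hmpos) (Finset.sum_pos' (fun e _ => hx0 e f)
      ⟨f, by simpa using hf, ?_⟩)
    simp [x, (hM f hf).2]
  · rw [Pi.smul_apply, smul_eq_mul, Finset.sum_apply, Finset.sum_eq_zero, mul_zero]
    exact fun e _ => if_neg fun h => hf ((M e).edgeSet_subset h)
  · rw [vsum_smul, vsum_sum, Finset.sum_congr rfl fun e he => hx e (by simpa using he) u,
      Finset.sum_const, nsmul_eq_mul, mul_one, inv_mul_cancel₀ hmpos.ne']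

theorem Covered.matchingCovered {G : SimpleGraph V} {c : V → Bool}
    (hc : ∀ u v, G.Adj u v → c u ≠ c v) (h : Covered G Finset.univ) : MatchingCovered G := by
  classical
  have hne : Nonempty V := Fintype.card_pos_iff.1 (by
    have := h.card
    rw [Finset.card_univ] at this
    omega)
  refine ⟨(connected_iff _).2
    ⟨fun u v => h.conn u (Finset.mem_univ _) v (Finset.mem_univ _), hne⟩, h.card, fun e he => ?_⟩
  obtain ⟨a, b, rfl, ha⟩ : ∃ a b, e = s(a, b) ∧ c a = true := by
    induction e with | _ a b => ?_
    by_cases ha : c a = true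
    · exact ⟨a, b, rfl, ha⟩
    · refine ⟨b, a, Sym2.eq_swap, ?_⟩
      have := hc _ _ he
      revert this ha
      cases c a <;> cases c b <;> simp
  obtain ⟨w, hw⟩ := h.weight
  obtain ⟨σ, hσ, hσab⟩ := hw.exists_perm h.mem he
  replace hσ : ∀ u, G.Adj u (σ u) := fun u => hσ u (Finset.mem_univ _)
  let M : G.Subgraph :=
    { verts := Set.univ
      Adj := fun u v => (c u = true ∧ σ u = v) ∨ (c v = true ∧ σ v = u)
      adj_sub := by
        rintro u v (⟨-, rfl⟩ | ⟨-, rfl⟩)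
        exacts [hσ _, (hσ _).symm]
      edge_vert := fun _ => Set.mem_univ _
      symm := ⟨fun _ _ h => h.symm⟩ }
  refine ⟨M, Subgraph.isPerfectMatching_iff.2 fun u => ?_, Or.inl ⟨ha, hσab⟩⟩
  cases hu : c u
  · have hs := hσ (σ.symm u)
    rw [σ.apply_symm_apply] at hs
    refine ⟨σ.symm u, Or.inr ⟨?_, σ.apply_symm_apply u⟩, ?_⟩
    · have := hc _ _ hs
      rw [hu] at this
      simpa using this
    · rintro y (⟨h1, -⟩ | ⟨-, h2⟩)
      · simp [hu] at h1
      · rw [← h2, σ.symm_apply_apply]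
  · refine ⟨σ u, Or.inl ⟨hu, rfl⟩, ?_⟩
    rintro y (⟨-, h2⟩ | ⟨h1, h2⟩)
    · exact h2.symm
    · have := hc _ _ (hσ y)
      rw [h2, hu, h1] at this
      exact absurd rfl this

theorem MinimalMatchingCovered.minCovered {G : SimpleGraph V} {c : V → Bool}
    (hc : ∀ u v, G.Adj u v → c u ≠ c v) (h : MinimalMatchingCovered G) :
    MinCovered G Finset.univ :=
  ⟨h.1.covered, fun e he hcov =>
    h.2 e he (hcov.matchingCovered fun u v huv => hc u v (deleteEdges_le _ huv))⟩

theorem Covered.two_mul_card_filter {G : SimpleGraph V} {R : Finset V} (h : Covered G R)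
    {c : V → Bool} (hc : ∀ u v, G.Adj u v → c u ≠ c v) (i : Bool) :
    2 * (R.filter fun u => c u = i).card = R.card := by
  have h1 := h.sum_sgn hc
  simp only [sgn, Finset.sum_ite, Finset.sum_const, nsmul_eq_mul, mul_one, mul_neg] at h1
  have h2 : (R.filter fun u => c u = true).card = (R.filter fun u => ¬ c u = true).card := by
    have : ((R.filter fun u => c u = true).card : ℝ) =
        (R.filter fun u => ¬ c u = true).card := by linarith
    exact_mod_cast this
  have h3 := Finset.card_filter_add_card_filter_not (s := R) (fun u => c u = true)
  have h4 : (R.filter fun u => ¬ c u = true) = R.filter fun u => c u = false := by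
    simp
  rw [h4] at h2 h3
  cases i <;> omega

theorem Covered.nonempty_iso_cycleGraph {G : SimpleGraph V} {c : V → Bool}
    (hc : ∀ u v, G.Adj u v → c u ≠ c v) (h : Covered G Finset.univ) (h4 : Fintype.card V = 4) :
    Nonempty (G ≃g cycleGraph 4) := by
  classical
  have hside : ∀ i, (Finset.univ.filter fun u => c u = i).card = 2 := fun i => by
    have := h.two_mul_card_filter hc i
    rw [Finset.card_univ, h4] at this
    omega
  have hadj : ∀ u v, G.Adj u v ↔ c u ≠ c v := by
    refine fun u v => ⟨hc u v, fun huv => ?_⟩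
    have h1 : G.neighborSet u ⊆ (Finset.univ.filter fun x => c x = c v : Finset V) := by
      intro x hx
      have := hc _ _ hx
      simp only [Finset.coe_filter, Finset.mem_univ, true_and, Set.mem_ofPred_eq]
      revert this huv
      cases c u <;> cases c v <;> cases c x <;> simp
    have h2 := Set.eq_of_subset_of_ncard_le h1 (by
      rw [Set.ncard_coe_finset, hside]
      exact h.two_le_degN (Finset.mem_univ u)) (Set.toFinite _)
    have : v ∈ G.neighborSet u := by rw [h2]; simp
    exact this
  obtain ⟨p, q, hpq, ht⟩ := Finset.card_eq_two.1 (hside true)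
  obtain ⟨r, s, hrs, hf⟩ := Finset.card_eq_two.1 (hside false)
  have htrue : c p = true ∧ c q = true := by
    have h1 : p ∈ Finset.univ.filter fun u => c u = true := by rw [ht]; simp
    have h2 : q ∈ Finset.univ.filter fun u => c u = true := by rw [ht]; simp
    simpa using And.intro h1 h2
  have hfalse : c r = false ∧ c s = false := by
    have h1 : r ∈ Finset.univ.filter fun u => c u = false := by rw [hf]; simp
    have h2 : s ∈ Finset.univ.filter fun u => c u = false := by rw [hf]; simp
    simpa using And.intro h1 h2
  have hne : ∀ {u v}, c u = true → c v = false → u ≠ v := by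
    rintro u v h1 h2 rfl
    simp [h1] at h2
  let φ : Fin 4 → V := ![p, r, q, s]
  have hφ : Function.Injective φ := by
    have h1 := hne htrue.1 hfalse.1
    have h2 := hne htrue.1 hfalse.2
    have h3 := hne htrue.2 hfalse.1
    have h5 := hne htrue.2 hfalse.2
    intro i j hij
    fin_cases i <;> fin_cases j <;>
      simp [φ, h1, h1.symm, h2, h2.symm, h3, h3.symm, h5, h5.symm, hpq, hpq.symm, hrs,
        hrs.symm] at hij ⊢
  have hcφ : ∀ i, c (φ i) = ![true, false, true, false] i := by
    intro i
    fin_cases i <;> simp [φ, htrue, hfalse]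
  have hcycle : ∀ i j : Fin 4, (![true, false, true, false] i ≠ ![true, false, true, false] j) ↔
      (cycleGraph 4).Adj i j := by decide
  refine ⟨RelIso.symm ⟨Equiv.ofBijective φ ((Fintype.bijective_iff_injective_and_card φ).2
    ⟨hφ, by simp [h4]⟩), ?_⟩⟩
  intro i j
  simp only [Equiv.ofBijective_apply]
  rw [hadj, hcφ, hcφ, hcycle]

end MatchingCovered

/-- A minimal bipartite matching covered graph, other than the 4-cycle, has an induced
matching `F` of 2-edges with `|F| ≥ m - n + 2`. -/
theorem stmt0 {V : Type*} [Fintype V] (G : SimpleGraph V)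
    (hbip : G.Colorable 2) (hmin : MinimalMatchingCovered G)
    (hC4 : IsEmpty (G ≃g cycleGraph 4)) :
    ∃ F : Set (Sym2 V),
      IsInducedMatching G F ∧ (∀ e ∈ F, IsTwoEdge G e) ∧
        G.edgeSet.ncard + 2 ≤ F.ncard + Fintype.card V := by
  obtain ⟨C⟩ := hbip
  let c : V → Bool := fun u => decide (C u = 0)
  have hc : ∀ u v, G.Adj u v → c u ≠ c v := by
    intro u v huv
    have := C.valid huv
    simp only [c, ne_eq, decide_eq_decide]
    omega
  have hG := hmin.minCovered hc
  have h4 : Fintype.card V ≠ 4 := fun h4 =>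
    not_nonempty_iff.2 hC4 (hG.1.nonempty_iso_cycleGraph hc h4)
  have h1 := hG.1.card
  have h2 := hG.1.two_mul_card_filter hc true
  rw [Finset.card_univ] at h1 h2
  exact hG.hasTwoEdgeMatching hc (by rw [Finset.card_univ]; omega)
end

section
/- Let G be a minimal bipartite matching covered graph. Then the number of vertices of degree exactly 2 in G is at least 2(m − n + 2), i.e. |V2| + 2n ≥ 2m + 4, where n is the number of vertices and m the number of edges of G. -/
open SimpleGraph

/-- The set of vertices adjacent to some vertex of `X`. -/
noncomputable def nbhd {V : Type*} [Fintype V] (G : SimpleGraph V) (X : Finset V) : Finset V :=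
  open Classical in {v | ∃ a ∈ X, G.Adj a v}

/-- `s` and its complement are the colour classes of a proper 2-colouring of `G`. -/
def IsColorClass {V : Type*} (G : SimpleGraph V) (s : Finset V) : Prop :=
  ∀ u v, G.Adj u v → (u ∈ s ↔ v ∉ s)

open Classical in
/-- Hall's condition with surplus one for the proper nonempty subsets of one half `s`
of the vertices. -/
def StrictHall {V : Type*} [Fintype V] (G : SimpleGraph V) (s : Finset V) : Prop :=
  s.card = sᶜ.card ∧ ∀ X ⊆ s, X.Nonempty → X ≠ s → X.card < (nbhd G X).card

/-- A set `X` of surplus exactly one in which `a` is the only neighbour of `b`. -/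
structure IsTightFor {V : Type*} [Fintype V] (G : SimpleGraph V) (s : Finset V) (a b : V)
    (X : Finset V) : Prop where
  subset : X ⊆ s
  ne : X ≠ s
  card_nbhd : (nbhd G X).card = X.card + 1
  mem : a ∈ X
  eq_of_adj : ∀ x ∈ X, G.Adj x b → x = a

section

open Classical

variable {V : Type*} {G : SimpleGraph V} {s : Finset V}

lemma IsColorClass.mono {H : SimpleGraph V} (h : IsColorClass G s) (hH : H ≤ G) :
    IsColorClass H s :=
  fun u v huv => h u v (hH huv)

/-- A perfect matching, seen as an involution. -/
lemma exists_involutive_of_isPerfectMatching {M : G.Subgraph} (hM : M.IsPerfectMatching) :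
    ∃ f : V → V, Function.Involutive f ∧ (∀ v, G.Adj v (f v)) ∧
      ∀ a b, M.Adj a b → f a = b := by
  rw [Subgraph.isPerfectMatching_iff] at hM
  choose f hf huniq using hM
  exact ⟨f, fun v => (huniq _ _ (hf v).symm).symm, fun v => (hf v).adj_sub,
    fun a b hab => (huniq _ _ hab).symm⟩

lemma SimpleGraph.Connected.mem_of_closed (h : G.Connected) {C : Set V} {u : V} (hu : u ∈ C)
    (hC : ∀ v ∈ C, ∀ w, G.Adj v w → w ∈ C) (v : V) : v ∈ C := by
  obtain ⟨p⟩ := h.preconnected u v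
  induction p with
  | nil => exact hu
  | cons hadj _ ih => exact ih (hC _ hu _ hadj)

variable [Fintype V]

@[simp] lemma mem_nbhd {X : Finset V} {v : V} : v ∈ nbhd G X ↔ ∃ a ∈ X, G.Adj a v := by
  simp [nbhd]

lemma nbhd_union (X Y : Finset V) : nbhd G (X ∪ Y) = nbhd G X ∪ nbhd G Y := by
  ext v; simp only [mem_nbhd, Finset.mem_union]; grind

lemma nbhd_inter_subset (X Y : Finset V) : nbhd G (X ∩ Y) ⊆ nbhd G X ∩ nbhd G Y := by
  intro v; simp only [mem_nbhd, Finset.mem_inter]; grind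

lemma degN_eq_card_nbhd (v : V) : degN G v = (nbhd G {v}).card := by
  rw [degN, ← Set.ncard_coe_finset]
  congr 1
  ext w
  simp

lemma IsColorClass.compl (h : IsColorClass G s) : IsColorClass G sᶜ := by
  intro u v huv
  have := h u v huv
  simp only [Finset.mem_compl]
  tauto

lemma IsColorClass.nbhd_subset (h : IsColorClass G s) {X : Finset V} (hX : X ⊆ s) :
    nbhd G X ⊆ sᶜ := by
  intro v hv
  obtain ⟨a, ha, hav⟩ := mem_nbhd.1 hv
  exact Finset.mem_compl.2 ((h a v hav).1 (hX ha))

lemma exists_isColorClass (h : G.Colorable 2) : ∃ s, IsColorClass G s := by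
  obtain ⟨c⟩ := h
  refine ⟨({v | c v = 0} : Finset V), fun u v huv => ?_⟩
  have := c.valid huv
  simp only [Finset.mem_filter, Finset.mem_univ, true_and]
  omega

lemma MatchingCovered.exists_involutive (h : MatchingCovered G) {a b : V} (hab : G.Adj a b) :
    ∃ f : V → V, Function.Involutive f ∧ (∀ v, G.Adj v (f v)) ∧ f a = b := by
  obtain ⟨M, hM, hMab⟩ := h.2.2 s(a, b) hab
  obtain ⟨f, hf, hadj, hfM⟩ := exists_involutive_of_isPerfectMatching hM
  exact ⟨f, hf, hadj, hfM _ _ hMab⟩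

lemma MatchingCovered.card_eq_card_compl (h : MatchingCovered G) (hs : IsColorClass G s) :
    s.card = sᶜ.card := by
  have : Nontrivial V := Fintype.one_lt_card_iff_nontrivial.1 (by have := h.2.1; omega)
  obtain ⟨v⟩ := h.1.nonempty
  obtain ⟨w, hvw⟩ := h.1.preconnected.exists_adj_of_nontrivial v
  obtain ⟨f, hf, hadj, -⟩ := h.exists_involutive hvw
  refine Finset.card_bij' (fun v _ => f v) (fun v _ => f v) ?_ ?_ ?_ ?_
  · intro a ha; exact Finset.mem_compl.2 ((hs _ _ (hadj a)).1 ha)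
  · intro a ha
    have := hs _ _ (hadj a)
    rw [Finset.mem_compl] at ha
    tauto
  · intro a _; exact hf a
  · intro a _; exact hf a

lemma MatchingCovered.strictHall (h : MatchingCovered G) (hs : IsColorClass G s) :
    StrictHall G s := by
  refine ⟨h.card_eq_card_compl hs, fun X hX ⟨x, hx⟩ hne => ?_⟩
  by_contra! hcard
  have hclosed : ∀ v ∈ (X ∪ nbhd G X : Finset V), ∀ w, G.Adj v w →
      w ∈ (X ∪ nbhd G X : Finset V) := by
    intro v hv w hvw
    rcases Finset.mem_union.1 hv with hv | hv
    · exact Finset.mem_union_right _ (mem_nbhd.2 ⟨v, hv, hvw⟩)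
    · obtain ⟨f, hf, hadj, hfv⟩ := h.exists_involutive hvw
      have himg : X.image f = nbhd G X := by
        refine Finset.eq_of_subset_of_card_le ?_ ?_
        · intro y hy
          obtain ⟨z, hz, rfl⟩ := Finset.mem_image.1 hy
          exact mem_nbhd.2 ⟨z, hz, hadj z⟩
        · rwa [Finset.card_image_of_injective _ hf.injective]
      rw [← himg] at hv
      obtain ⟨z, hz, rfl⟩ := Finset.mem_image.1 hv
      rw [hf z] at hfv
      exact Finset.mem_union_left _ (hfv ▸ hz)
  have hall := h.1.mem_of_closed (C := ((X ∪ nbhd G X : Finset V) : Set V))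
    (Finset.mem_coe.2 (Finset.mem_union_left _ hx)) hclosed
  refine hne (hX.antisymm fun v hv => ?_)
  rcases Finset.mem_union.1 (Finset.mem_coe.1 (hall v)) with h1 | h1
  · exact h1
  · exact absurd hv (Finset.mem_compl.1 (hs.nbhd_subset hX h1))

namespace StrictHall

lemma two_mul_card (h : StrictHall G s) : 2 * s.card = Fintype.card V := by
  have := Finset.card_add_card_compl s
  have := h.1
  omega

lemma nbhd_erase (h : StrictHall G s) (hs : IsColorClass G s) (hV : 4 ≤ Fintype.card V) {a : V}
    (ha : a ∈ s) : nbhd G (s.erase a) = sᶜ := by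
  have h2 := h.two_mul_card
  have hc := Finset.card_erase_of_mem ha
  refine Finset.eq_of_subset_of_card_le (hs.nbhd_subset (Finset.erase_subset _ _)) ?_
  have := h.2 (s.erase a) (Finset.erase_subset _ _) (Finset.card_pos.1 (by omega))
    (fun h' => by rw [h'] at hc; omega)
  have := h.1
  omega

lemma exists_adj_ne (h : StrictHall G s) (hs : IsColorClass G s) (hV : 4 ≤ Fintype.card V)
    {b : V} (hb : b ∉ s) (a : V) : ∃ c ∈ s, c ≠ a ∧ G.Adj c b := by
  have h2 := h.two_mul_card
  by_cases ha : a ∈ s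
  · have : b ∈ nbhd G (s.erase a) := by
      rw [h.nbhd_erase hs hV ha]; exact Finset.mem_compl.2 hb
    obtain ⟨c, hc, hcb⟩ := mem_nbhd.1 this
    exact ⟨c, Finset.mem_of_mem_erase hc, Finset.ne_of_mem_erase hc, hcb⟩
  · obtain ⟨x, hx⟩ := Finset.card_pos.1 (show 0 < s.card by omega)
    have : b ∈ nbhd G (s.erase x) := by
      rw [h.nbhd_erase hs hV hx]; exact Finset.mem_compl.2 hb
    obtain ⟨c, hc, hcb⟩ := mem_nbhd.1 this
    have hc := Finset.mem_of_mem_erase hc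
    exact ⟨c, hc, fun hca => ha (hca ▸ hc), hcb⟩

lemma connected (h : StrictHall G s) (hs : IsColorClass G s) (hV : 4 ≤ Fintype.card V) :
    G.Connected := by
  have h2 := h.two_mul_card
  have hne : Nonempty V := Fintype.card_pos_iff.1 (by omega)
  refine ⟨fun u => ?_⟩
  let C : Finset V := {v | G.Reachable u v}
  have hC : ∀ v w, G.Adj v w → (v ∈ C ↔ w ∈ C) := by
    intro v w hvw
    simp only [C, Finset.mem_filter, Finset.mem_univ, true_and]
    exact ⟨fun h' => h'.trans hvw.reachable, fun h' => h'.trans hvw.symm.reachable⟩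
  have huC : u ∈ C := by simp [C]
  have hXne : (s ∩ C).Nonempty := by
    by_cases hu : u ∈ s
    · exact ⟨u, Finset.mem_inter.2 ⟨hu, huC⟩⟩
    · obtain ⟨c, hc, -, hcu⟩ := h.exists_adj_ne hs hV hu u
      exact ⟨c, Finset.mem_inter.2 ⟨hc, (hC c u hcu).2 huC⟩⟩
  have hsC : s ⊆ C := by
    by_contra hnot
    obtain ⟨y, hys, hyC⟩ := Finset.not_subset.1 hnot
    obtain ⟨x, hx⟩ := hXne
    have hx := Finset.mem_inter.1 hx
    have h1 := h.2 (s ∩ C) Finset.inter_subset_left ⟨x, Finset.mem_inter.2 hx⟩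
      (fun h' => hnot (Finset.inter_eq_left.1 h'))
    have h2 := h.2 (s \ C) Finset.sdiff_subset ⟨y, Finset.mem_sdiff.2 ⟨hys, hyC⟩⟩
      (fun h' => (Finset.mem_sdiff.1 (h' ▸ hx.1)).2 hx.2)
    have hdisj : Disjoint (nbhd G (s ∩ C)) (nbhd G (s \ C)) := by
      rw [Finset.disjoint_left]
      intro v hv hv'
      obtain ⟨p, hp, hpv⟩ := mem_nbhd.1 hv
      obtain ⟨q, hq, hqv⟩ := mem_nbhd.1 hv'
      exact (Finset.mem_sdiff.1 hq).2
        ((hC q v hqv).2 ((hC p v hpv).1 (Finset.mem_inter.1 hp).2))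
    have h3 := Finset.card_le_card (Finset.union_subset
      (hs.nbhd_subset (Finset.inter_subset_left (s₁ := s) (s₂ := C)))
      (hs.nbhd_subset (Finset.sdiff_subset (s := s) (t := C))))
    rw [Finset.card_union_of_disjoint hdisj] at h3
    have h4 := Finset.card_inter_add_card_sdiff s C
    have := h.1
    omega
  intro v
  have hvC : v ∈ C := by
    by_cases hv : v ∈ s
    · exact hsC hv
    · obtain ⟨c, hc, -, hcv⟩ := h.exists_adj_ne hs hV hv v
      exact (hC c v hcv).1 (hsC hc)
  simpa [C] using hvC

/-- Hall's theorem, for a matching through a prescribed edge. -/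
lemma exists_injOn (h : StrictHall G s) {a b : V} (ha : a ∈ s) (hab : G.Adj a b) :
    ∃ g : V → V, Set.InjOn g s ∧ (∀ x ∈ s, G.Adj x (g x)) ∧ g a = b := by
  let t : s → Finset V := fun x => {v | G.Adj x v ∧ ((x : V) = a ↔ v = b)}
  have hall : ∀ S : Finset s, S.card ≤ (S.biUnion t).card := by
    intro S
    let X : Finset V := S.image Subtype.val
    have hXs : X ⊆ s := by
      intro x hx
      obtain ⟨y, -, rfl⟩ := Finset.mem_image.1 hx
      exact y.2
    have hXc : X.card = S.card := Finset.card_image_of_injective _ Subtype.val_injective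
    have hmem : ∀ x (hx : x ∈ X), ∀ v, G.Adj x v → (x = a ↔ v = b) → v ∈ S.biUnion t := by
      intro x hx v hxv hiff
      obtain ⟨y, hy, rfl⟩ := Finset.mem_image.1 hx
      exact Finset.mem_biUnion.2 ⟨y, hy, by simp [t, hxv, hiff]⟩
    have hsub : (nbhd G (X.erase a)).erase b ⊆ S.biUnion t := by
      intro v hv
      obtain ⟨hvb, hv⟩ := Finset.mem_erase.1 hv
      obtain ⟨x, hx, hxv⟩ := mem_nbhd.1 hv
      obtain ⟨hxa, hx⟩ := Finset.mem_erase.1 hx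
      exact hmem x hx v hxv (by tauto)
    have hstrict : (X.erase a).Nonempty →
        (X.erase a).card ≤ ((nbhd G (X.erase a)).erase b).card := by
      intro hne
      have := h.2 (X.erase a) ((Finset.erase_subset _ _).trans hXs) hne
        (fun h' => Finset.notMem_erase a X (h' ▸ ha))
      have := Finset.pred_card_le_card_erase (s := nbhd G (X.erase a)) (a := b)
      omega
    have hweak : (X.erase a).card ≤ ((nbhd G (X.erase a)).erase b).card := by
      rcases (X.erase a).eq_empty_or_nonempty with h0 | h0
      · simp [h0]
      · exact hstrict h0
    rw [← hXc]
    by_cases haX : a ∈ X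
    · have hb : insert b ((nbhd G (X.erase a)).erase b) ⊆ S.biUnion t :=
        Finset.insert_subset (hmem a haX b hab (by simp)) hsub
      have h1 := Finset.card_le_card hb
      rw [Finset.card_insert_of_notMem (Finset.notMem_erase _ _)] at h1
      have := Finset.card_erase_add_one haX
      omega
    · rw [Finset.erase_eq_of_notMem haX] at hweak hsub
      exact hweak.trans (Finset.card_le_card hsub)
  obtain ⟨g, hg, hgt⟩ := (Finset.all_card_le_biUnion_card_iff_exists_injective t).1 hall
  have hgt' : ∀ x : s, G.Adj x (g x) ∧ ((x : V) = a ↔ g x = b) := fun x => by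
    simpa [t] using hgt x
  refine ⟨fun v => if hv : v ∈ s then g ⟨v, hv⟩ else v, ?_, ?_, ?_⟩
  · intro x hx y hy hxy
    have hx : x ∈ s := hx
    have hy : y ∈ s := hy
    simp only [hx, hy, dif_pos] at hxy
    exact congrArg Subtype.val (hg hxy)
  · intro x hx
    simp only [hx, dif_pos]
    exact (hgt' ⟨x, hx⟩).1
  · simp only [ha, dif_pos]
    exact (hgt' ⟨a, ha⟩).2.1 rfl

lemma exists_isPerfectMatching (h : StrictHall G s) (hs : IsColorClass G s) {a b : V}
    (ha : a ∈ s) (hab : G.Adj a b) :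
    ∃ M : G.Subgraph, M.IsPerfectMatching ∧ s(a, b) ∈ M.edgeSet := by
  obtain ⟨g, hinj, hadj, hga⟩ := h.exists_injOn ha hab
  let M : G.Subgraph :=
    { verts := Set.univ
      Adj := fun u v => (u ∈ s ∧ g u = v) ∨ (v ∈ s ∧ g v = u)
      adj_sub := by
        rintro u v (⟨hu, rfl⟩ | ⟨hv, rfl⟩)
        · exact hadj u hu
        · exact (hadj v hv).symm
      edge_vert := fun _ => Set.mem_univ _
      symm := ⟨fun u v huv => huv.symm⟩ }
  have hgs : ∀ x ∈ s, g x ∉ s := fun x hx => (hs _ _ (hadj x hx)).1 hx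
  have himg : s.image g = sᶜ := by
    refine Finset.eq_of_subset_of_card_le ?_ ?_
    · intro y hy
      obtain ⟨x, hx, rfl⟩ := Finset.mem_image.1 hy
      exact Finset.mem_compl.2 (hgs x hx)
    · rw [Finset.card_image_of_injOn hinj, h.1]
  refine ⟨M, Subgraph.isPerfectMatching_iff.2 fun v => ?_, Or.inl ⟨ha, hga⟩⟩
  by_cases hv : v ∈ s
  · refine ⟨g v, Or.inl ⟨hv, rfl⟩, ?_⟩
    rintro w (⟨-, hw⟩ | ⟨hw, rfl⟩)
    · exact hw.symm
    · exact absurd hv (hgs w hw)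
  · have : v ∈ s.image g := himg ▸ Finset.mem_compl.2 hv
    obtain ⟨x, hx, rfl⟩ := Finset.mem_image.1 this
    refine ⟨x, Or.inr ⟨hx, rfl⟩, ?_⟩
    rintro w (⟨hw, -⟩ | ⟨hw, hwx⟩)
    · exact absurd hw hv
    · exact hinj hw hx hwx

lemma matchingCovered (h : StrictHall G s) (hs : IsColorClass G s) (hV : 4 ≤ Fintype.card V) :
    MatchingCovered G := by
  refine ⟨h.connected hs hV, hV, fun e => Sym2.ind (fun u v huv => ?_) e⟩
  have huv : G.Adj u v := huv
  by_cases hu : u ∈ s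
  · exact h.exists_isPerfectMatching hs hu huv
  · have hv : v ∈ s := by
      have := hs u v huv
      tauto
    rw [Sym2.eq_swap]
    exact h.exists_isPerfectMatching hs hv huv.symm

lemma card_le_card_nbhd (h : StrictHall G s) (hs : IsColorClass G s) (hV : 4 ≤ Fintype.card V)
    {X : Finset V} (hX : X ⊆ s) : X.card ≤ (nbhd G X).card := by
  rcases X.eq_empty_or_nonempty with rfl | hne
  · simp
  by_cases hXs : X = s
  · subst hXs
    obtain ⟨a, ha⟩ := hne
    have h1 := h.nbhd_erase hs hV ha
    have h2 : nbhd G (X.erase a) ⊆ nbhd G X := by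
      intro v hv
      obtain ⟨x, hx, hxv⟩ := mem_nbhd.1 hv
      exact mem_nbhd.2 ⟨x, Finset.mem_of_mem_erase hx, hxv⟩
    rw [h.1, ← h1]
    exact Finset.card_le_card h2
  · exact (h.2 X hX hne hXs).le

lemma two_le_degN (h : StrictHall G s) (hV : 4 ≤ Fintype.card V) {a : V} (ha : a ∈ s) :
    2 ≤ degN G a := by
  have h2 := h.two_mul_card
  rw [degN_eq_card_nbhd]
  have := h.2 {a} (by simpa using ha) (by simp) (fun h' => by
    have := congrArg Finset.card h'
    simp at this
    omega)
  rwa [Finset.card_singleton] at this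

end StrictHall

lemma MinimalMatchingCovered.exists_isTightFor (h : MinimalMatchingCovered G)
    (hs : IsColorClass G s) {a b : V} (ha : a ∈ s) (hab : G.Adj a b) :
    ∃ X, IsTightFor G s a b X := by
  have hG := h.1.strictHall hs
  have hV := h.1.2.1
  have hnot : ¬ StrictHall (G.deleteEdges {s(a, b)}) s := fun h' =>
    h.2 s(a, b) hab (h'.matchingCovered (hs.mono (deleteEdges_le _)) hV)
  rw [StrictHall, not_and] at hnot
  have hnot := hnot hG.1
  push Not at hnot
  obtain ⟨X, hX, hne, hXs, hcard⟩ := hnot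
  have hlt := hG.2 X hX hne hXs
  have hdel : ∀ x ∈ X, ∀ v, G.Adj x v → ¬ (x = a ∧ v = b) →
      v ∈ nbhd (G.deleteEdges {s(a, b)}) X := by
    intro x hx v hxv hne
    refine mem_nbhd.2 ⟨x, hx, ?_⟩
    rw [deleteEdges_adj]
    refine ⟨hxv, fun heq => ?_⟩
    rcases Sym2.eq_iff.1 (Set.mem_singleton_iff.1 heq) with h1 | ⟨rfl, rfl⟩
    · exact hne h1
    · exact (hs _ _ hab).1 ha (hX hx)
  have hsub : nbhd G X ⊆ insert b (nbhd (G.deleteEdges {s(a, b)}) X) := by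
    intro v hv
    obtain ⟨x, hx, hxv⟩ := mem_nbhd.1 hv
    by_cases hvb : v = b
    · exact Finset.mem_insert.2 (Or.inl hvb)
    · exact Finset.mem_insert_of_mem (hdel x hx v hxv (by tauto))
  have hb : b ∉ nbhd (G.deleteEdges {s(a, b)}) X := fun hb => by
    rw [Finset.insert_eq_of_mem hb] at hsub
    have := Finset.card_le_card hsub
    omega
  have hins := Finset.card_le_card hsub
  rw [Finset.card_insert_of_notMem hb] at hins
  have hXb : ∀ x ∈ X, G.Adj x b → x = a := by
    intro x hx hxb
    by_contra hxa
    exact hb (hdel x hx b hxb (by tauto))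
  refine ⟨X, hX, hXs, by omega, ?_, hXb⟩
  by_contra haX
  have hsub' : nbhd G X ⊆ nbhd (G.deleteEdges {s(a, b)}) X := by
    intro v hv
    obtain ⟨x, hx, hxv⟩ := mem_nbhd.1 hv
    exact hdel x hx v hxv (fun h' => haX (h'.1 ▸ hx))
  have := Finset.card_le_card hsub'
  omega

/-- Uncrossing of two tight sets at different edges of a vertex of degree other than two. -/
lemma IsTightFor.union_eq (h : StrictHall G s) {a b c : V} (hab : G.Adj a b) (hac : G.Adj a c)
    (hbc : b ≠ c) (hdeg : degN G a ≠ 2) {X Y : Finset V} (hX : IsTightFor G s a b X)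
    (hY : IsTightFor G s a c Y) : X ∪ Y = s := by
  by_contra hne
  have haZ : a ∈ X ∩ Y := Finset.mem_inter.2 ⟨hX.mem, hY.mem⟩
  have h1 := h.2 (X ∪ Y) (Finset.union_subset hX.subset hY.subset)
    ⟨a, Finset.mem_union_left _ hX.mem⟩ hne
  rw [nbhd_union] at h1
  have h2 := Finset.card_le_card (nbhd_inter_subset (G := G) X Y)
  have h3 := Finset.card_union_add_card_inter (nbhd G X) (nbhd G Y)
  have h4 := Finset.card_union_add_card_inter X Y
  have h5 := hX.card_nbhd
  have h6 := hY.card_nbhd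
  have hZs : X ∩ Y ⊆ s := Finset.inter_subset_left.trans hX.subset
  have hsub : nbhd G ((X ∩ Y).erase a) ⊆ ((nbhd G (X ∩ Y)).erase b).erase c := by
    intro v hv
    obtain ⟨x, hx, hxv⟩ := mem_nbhd.1 hv
    obtain ⟨hxa, hx⟩ := Finset.mem_erase.1 hx
    obtain ⟨hxX, hxY⟩ := Finset.mem_inter.1 hx
    refine Finset.mem_erase.2 ⟨?_, Finset.mem_erase.2 ⟨?_, mem_nbhd.2 ⟨x, hx, hxv⟩⟩⟩
    · rintro rfl; exact hxa (hY.eq_of_adj x hxY hxv)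
    · rintro rfl; exact hxa (hX.eq_of_adj x hxX hxv)
  have hcsub := Finset.card_le_card hsub
  have hb : b ∈ nbhd G (X ∩ Y) := mem_nbhd.2 ⟨a, haZ, hab⟩
  have hc : c ∈ (nbhd G (X ∩ Y)).erase b :=
    Finset.mem_erase.2 ⟨hbc.symm, mem_nbhd.2 ⟨a, haZ, hac⟩⟩
  have h7 := Finset.card_erase_add_one hb
  have h8 := Finset.card_erase_add_one hc
  have h9 := Finset.card_erase_add_one haZ
  rcases ((X ∩ Y).erase a).eq_empty_or_nonempty with h0 | h0
  · have hZ : X ∩ Y = {a} := by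
      rw [← Finset.insert_erase haZ, h0]
      simp
    rw [hZ, ← degN_eq_card_nbhd] at h2 h7
    rw [hZ] at h4 h8
    simp at h4
    omega
  · have := h.2 _ ((Finset.erase_subset _ _).trans hZs) h0
      (fun h' => Finset.notMem_erase a (X ∩ Y) (h' ▸ hZs haZ))
    omega

/-- Along a path `a b a' b'` with `a'` of degree other than two, tight sets increase. -/
lemma IsTightFor.ssubset (h : StrictHall G s) (hs : IsColorClass G s)
    (hV : 4 ≤ Fintype.card V) {a b a' b' : V} {S T R : Finset V}
    (hT : IsTightFor G s a b T) (hmin : ∀ Y, IsTightFor G s a b Y → T.card ≤ Y.card)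
    (hR : IsTightFor G s a' b R) (hS : IsTightFor G s a' b' S)
    (hab : G.Adj a b) (ha'b : G.Adj a' b) (ha'b' : G.Adj a' b')
    (haa' : a' ≠ a) (hbb' : b' ≠ b) (hdeg : degN G a' ≠ 2) : T ⊂ S := by
  have hRS := hR.union_eq h ha'b ha'b' hbb'.symm hdeg hS
  have haS : a ∈ S := by
    have : a ∈ R ∪ S := hRS ▸ hT.subset hT.mem
    rcases Finset.mem_union.1 this with h1 | h1
    · exact absurd (hR.eq_of_adj a h1 hab).symm haa'
    · exact h1
  have ha'T : a' ∉ T := fun h' => haa' (hT.eq_of_adj a' h' ha'b)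
  have haI : a ∈ S ∩ T := Finset.mem_inter.2 ⟨haS, hT.mem⟩
  have hIs : S ∩ T ⊆ s := Finset.inter_subset_left.trans hS.subset
  have hIne : S ∩ T ≠ s := fun h' => ha'T (Finset.mem_inter.1 (h' ▸ hS.subset hS.mem)).2
  have hUs : S ∪ T ⊆ s := Finset.union_subset hS.subset hT.subset
  have h2 := Finset.card_le_card (nbhd_inter_subset (G := G) S T)
  have h3 := Finset.card_union_add_card_inter (nbhd G S) (nbhd G T)
  have h4 := Finset.card_union_add_card_inter S T
  have h5 := hS.card_nbhd
  have h6 := hT.card_nbhd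
  have h7 := h.2 _ hIs ⟨a, haI⟩ hIne
  have hle : (nbhd G (S ∩ T)).card ≤ (S ∩ T).card + 1 := by
    by_cases hU : S ∪ T = s
    · have h8 := h.card_le_card_nbhd hs hV hUs
      rw [nbhd_union] at h8
      have hb's : b' ∉ s := (hs _ _ ha'b').1 (hS.subset hS.mem)
      obtain ⟨c, hcs, hca', hcb'⟩ := h.exists_adj_ne hs hV hb's a'
      have hcT : c ∈ T := by
        rcases Finset.mem_union.1 (hU ▸ hcs : c ∈ S ∪ T) with h1 | h1
        · exact absurd (hS.eq_of_adj c h1 hcb') hca'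
        · exact h1
      have hb'1 : b' ∈ nbhd G S ∩ nbhd G T :=
        Finset.mem_inter.2 ⟨mem_nbhd.2 ⟨a', hS.mem, ha'b'⟩, mem_nbhd.2 ⟨c, hcT, hcb'⟩⟩
      have hb'2 : b' ∉ nbhd G (S ∩ T) := by
        intro h'
        obtain ⟨x, hx, hxb'⟩ := mem_nbhd.1 h'
        obtain ⟨hxS, hxT⟩ := Finset.mem_inter.1 hx
        exact ha'T (hS.eq_of_adj x hxS hxb' ▸ hxT)
      have h9 := Finset.card_lt_card
        ((Finset.ssubset_iff_of_subset (nbhd_inter_subset S T)).2 ⟨b', hb'1, hb'2⟩)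
      omega
    · have h8 := h.2 _ hUs ⟨a, Finset.mem_union_left _ haS⟩ hU
      rw [nbhd_union] at h8
      omega
  have hgood : IsTightFor G s a b (S ∩ T) :=
    ⟨hIs, hIne, by omega, haI, fun x hx => hT.eq_of_adj x (Finset.mem_inter.1 hx).2⟩
  have hTS : T ⊆ S := Finset.inter_eq_right.1
    (Finset.eq_of_subset_of_card_le Finset.inter_subset_right (hmin _ hgood))
  exact (Finset.ssubset_iff_of_subset hTS).2 ⟨a', hS.mem, ha'T⟩

/-- A bipartite graph with at least as many edges as vertices contains a nonempty subgraph of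
minimum degree at least two. -/
lemma exists_core {α β : Type*} (F : Finset (α × β)) (hne : F.Nonempty)
    (hF : (F.image Prod.fst).card + (F.image Prod.snd).card ≤ F.card) :
    ∃ C ⊆ F, C.Nonempty ∧ (∀ e ∈ C, ∃ e' ∈ C, e' ≠ e ∧ e'.1 = e.1) ∧
      ∀ e ∈ C, ∃ e' ∈ C, e' ≠ e ∧ e'.2 = e.2 := by
  induction F using Finset.strongInduction with
  | H F ih =>
    by_cases hcore : (∀ e ∈ F, ∃ e' ∈ F, e' ≠ e ∧ e'.1 = e.1) ∧
      ∀ e ∈ F, ∃ e' ∈ F, e' ≠ e ∧ e'.2 = e.2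
    · exact ⟨F, subset_rfl, hne, hcore⟩
    · have hpos1 := Finset.card_pos.2 (hne.image Prod.fst)
      have hpos2 := Finset.card_pos.2 (hne.image Prod.snd)
      obtain ⟨e, he, hlt⟩ : ∃ e ∈ F, ((F.erase e).image Prod.fst).card +
          ((F.erase e).image Prod.snd).card < (F.image Prod.fst).card +
            (F.image Prod.snd).card := by
        rw [not_and_or] at hcore
        rcases hcore with hc | hc
        · push Not at hc
          obtain ⟨e, he, hc⟩ := hc
          refine ⟨e, he, add_lt_add_of_lt_of_le (Finset.card_lt_card ?_)
            (Finset.card_le_card (Finset.image_subset_image (Finset.erase_subset _ _)))⟩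
          refine (Finset.ssubset_iff_of_subset
            (Finset.image_subset_image (Finset.erase_subset _ _))).2
            ⟨e.1, Finset.mem_image_of_mem _ he, fun h' => ?_⟩
          obtain ⟨e', he', heq⟩ := Finset.mem_image.1 h'
          exact hc e' (Finset.mem_of_mem_erase he') (Finset.ne_of_mem_erase he') heq
        · push Not at hc
          obtain ⟨e, he, hc⟩ := hc
          refine ⟨e, he, add_lt_add_of_le_of_lt
            (Finset.card_le_card (Finset.image_subset_image (Finset.erase_subset _ _)))
            (Finset.card_lt_card ?_)⟩
          refine (Finset.ssubset_iff_of_subset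
            (Finset.image_subset_image (Finset.erase_subset _ _))).2
            ⟨e.2, Finset.mem_image_of_mem _ he, fun h' => ?_⟩
          obtain ⟨e', he', heq⟩ := Finset.mem_image.1 h'
          exact hc e' (Finset.mem_of_mem_erase he') (Finset.ne_of_mem_erase he') heq
      have hc := Finset.card_erase_add_one he
      obtain ⟨C, hCF, hC⟩ := ih (F.erase e) (Finset.erase_ssubset he)
        (Finset.card_pos.1 (by omega)) (by omega)
      exact ⟨C, hCF.trans (Finset.erase_subset _ _), hC⟩

/-- In a minimal bipartite matching covered graph, every subgraph of minimum degree at least two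
has two vertices in `s` that have degree two in the whole graph. -/
lemma MinimalMatchingCovered.not_core (h : MinimalMatchingCovered G) (hs : IsColorClass G s)
    (C : Finset (V × V)) (hne : C.Nonempty) (hCs : ∀ e ∈ C, e.1 ∈ s ∧ G.Adj e.1 e.2)
    (h1 : ∀ e ∈ C, ∃ e' ∈ C, e' ≠ e ∧ e'.1 = e.1)
    (h2 : ∀ e ∈ C, ∃ e' ∈ C, e' ≠ e ∧ e'.2 = e.2) (a₀ : V)
    (hdeg : ∀ e ∈ C, e.1 = a₀ ∨ degN G e.1 ≠ 2) : False := by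
  have hG := h.1.strictHall hs
  have hV := h.1.2.1
  obtain ⟨e₀, he₀, hdeg₀⟩ : ∃ e₀ ∈ C, ∀ e ∈ C, e.1 = e₀.1 ∨ degN G e.1 ≠ 2 := by
    by_cases h0 : ∃ e ∈ C, e.1 = a₀
    · obtain ⟨e, he, rfl⟩ := h0
      exact ⟨e, he, hdeg⟩
    · push Not at h0
      obtain ⟨e, he⟩ := hne
      exact ⟨e, he, fun f hf => Or.inr ((hdeg f hf).resolve_left (h0 f hf))⟩
  have hT : ∀ e ∈ C, ∃ T, IsTightFor G s e.1 e.2 T ∧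
      ∀ Y, IsTightFor G s e.1 e.2 Y → T.card ≤ Y.card := by
    intro e he
    obtain ⟨X, hX⟩ := h.exists_isTightFor hs (hCs e he).1 (hCs e he).2
    obtain ⟨T, hT, hmin⟩ := Finset.exists_min_image
      ({X | IsTightFor G s e.1 e.2 X} : Finset (Finset V)) Finset.card ⟨X, by simpa using hX⟩
    exact ⟨T, by simpa using hT, fun Y hY => hmin Y (by simpa using hY)⟩
  choose! T hT hTmin using hT
  obtain ⟨e, he, hmax⟩ := Finset.exists_max_image (C.filter fun e => e₀.1 ∈ T e)
    (fun e => (T e).card) ⟨e₀, Finset.mem_filter.2 ⟨he₀, (hT e₀ he₀).mem⟩⟩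
  obtain ⟨heC, heT⟩ := Finset.mem_filter.1 he
  obtain ⟨f, hfC, hfe, hfe2⟩ := h2 e heC
  obtain ⟨g, hgC, hgf, hgf1⟩ := h1 f hfC
  have hfe1 : f.1 ≠ e.1 := fun h' => hfe (Prod.ext h' hfe2)
  have hgf2 : g.2 ≠ f.2 := fun h' => hgf (Prod.ext hgf1 h')
  have hfadj : G.Adj f.1 e.2 := hfe2 ▸ (hCs f hfC).2
  have hf0 : f.1 ≠ e₀.1 := by
    intro h'
    rw [← h'] at heT
    exact hfe1 ((hT e heC).eq_of_adj _ heT hfadj)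
  have hss : T e ⊂ T g :=
    (hT e heC).ssubset hG hs hV (hTmin e heC) (hfe2 ▸ hT f hfC) (hgf1 ▸ hT g hgC)
      (hCs e heC).2 hfadj (hgf1 ▸ (hCs g hgC).2) hfe1 (hfe2 ▸ hgf2)
      ((hdeg₀ f hfC).resolve_left hf0)
  have := hmax g (Finset.mem_filter.2 ⟨hgC, hss.1 heT⟩)
  have := Finset.card_lt_card hss
  omega

lemma MinimalMatchingCovered.sum_degN_lt (h : MinimalMatchingCovered G) (hs : IsColorClass G s)
    (hne : s.Nonempty) (a₀ : V) :
    ∑ a ∈ s with a = a₀ ∨ degN G a ≠ 2, degN G a <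
      (s.filter fun a => a = a₀ ∨ degN G a ≠ 2).card + sᶜ.card := by
  set W := s.filter fun a => a = a₀ ∨ degN G a ≠ 2 with hW
  let F : Finset (V × V) := (W ×ˢ Finset.univ).filter fun e => G.Adj e.1 e.2
  have hmem : ∀ e, e ∈ F ↔ e.1 ∈ W ∧ G.Adj e.1 e.2 := by simp [F]
  have hFcard : F.card = ∑ a ∈ W, degN G a := by
    rw [Finset.card_eq_sum_card_fiberwise (f := Prod.fst) (t := W)
      (fun e he => ((hmem e).1 he).1)]
    refine Finset.sum_congr rfl fun a ha => ?_
    rw [degN_eq_card_nbhd]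
    refine Finset.card_bij (fun e _ => e.2) ?_ ?_ ?_
    · intro e he
      obtain ⟨heF, rfl⟩ := Finset.mem_filter.1 he
      exact mem_nbhd.2 ⟨e.1, by simp, ((hmem e).1 heF).2⟩
    · intro e he e' he' heq
      exact Prod.ext ((Finset.mem_filter.1 he).2.trans (Finset.mem_filter.1 he').2.symm) heq
    · intro b hb
      refine ⟨(a, b), Finset.mem_filter.2 ⟨(hmem _).2 ⟨ha, ?_⟩, rfl⟩, rfl⟩
      simpa using hb
  rw [← hFcard]
  by_contra! hle
  have hcpos : 0 < sᶜ.card := by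
    rw [← (h.1.strictHall hs).1]; exact Finset.card_pos.2 hne
  have hi1 : (F.image Prod.fst).card ≤ W.card := Finset.card_le_card fun a ha => by
    obtain ⟨e, he, rfl⟩ := Finset.mem_image.1 ha
    exact ((hmem e).1 he).1
  have hi2 : (F.image Prod.snd).card ≤ sᶜ.card := Finset.card_le_card fun b hb => by
    obtain ⟨e, he, rfl⟩ := Finset.mem_image.1 hb
    obtain ⟨heW, hadj⟩ := (hmem e).1 he
    exact Finset.mem_compl.2 ((hs _ _ hadj).1 (Finset.mem_filter.1 heW).1)
  obtain ⟨C, hCF, hCne, h1, h2⟩ := exists_core F (Finset.card_pos.1 (by omega)) (by omega)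
  refine h.not_core hs C hCne (fun e he => ?_) h1 h2 a₀ (fun e he => ?_)
  · obtain ⟨heW, hadj⟩ := (hmem e).1 (hCF he)
    exact ⟨(Finset.mem_filter.1 heW).1, hadj⟩
  · exact (Finset.mem_filter.1 ((hmem e).1 (hCF he)).1).2

lemma MinimalMatchingCovered.sum_degN_add_two_le (h : MinimalMatchingCovered G)
    (hs : IsColorClass G s) :
    ∑ a ∈ s, degN G a + 2 ≤ (s.filter fun a => degN G a = 2).card + Fintype.card V := by
  have hG := h.1.strictHall hs
  have hV := h.1.2.1
  have hc := hG.two_mul_card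
  have hc' := hG.1
  have hne : s.Nonempty := Finset.card_pos.1 (by omega)
  rcases (s.filter fun a => degN G a = 2).eq_empty_or_nonempty with h0 | ⟨a₀, ha₀⟩
  · have ⟨a₀, _⟩ := hne
    have hlt := h.sum_degN_lt hs hne a₀
    have hW : (s.filter fun a => a = a₀ ∨ degN G a ≠ 2) = s :=
      Finset.filter_true_of_mem fun a ha => Or.inr fun h' =>
        Finset.notMem_empty a (h0 ▸ Finset.mem_filter.2 ⟨ha, h'⟩)
    rw [hW] at hlt
    have hsum : s.card * 2 ≤ ∑ a ∈ s, degN G a :=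
      Finset.card_nsmul_le_sum s (degN G) 2 fun a ha => hG.two_le_degN hV ha
    omega
  · have hlt := h.sum_degN_lt hs hne a₀
    have hcompl : (s.filter fun a => ¬ (a = a₀ ∨ degN G a ≠ 2)) =
        (s.filter fun a => degN G a = 2).erase a₀ := by
      ext a
      simp only [Finset.mem_filter, Finset.mem_erase]
      tauto
    have h1 := Finset.sum_filter_add_sum_filter_not s
      (fun a => a = a₀ ∨ degN G a ≠ 2) (degN G)
    have h2 := Finset.card_filter_add_card_filter_not (s := s)
      (fun a => a = a₀ ∨ degN G a ≠ 2)
    rw [hcompl] at h1 h2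
    have h3 := Finset.card_erase_add_one ha₀
    rw [Finset.sum_const_nat (m := 2) (fun a ha =>
      (Finset.mem_filter.1 (Finset.mem_of_mem_erase ha)).2)] at h1
    omega

lemma IsColorClass.sum_degN (hs : IsColorClass G s) :
    ∑ a ∈ s, degN G a = G.edgeSet.ncard := by
  have hb : G.IsBipartiteWith (s : Set V) ((sᶜ : Finset V) : Set V) :=
    ⟨by rw [Finset.disjoint_coe]; exact disjoint_compl_right, fun u v huv => by
      have := hs u v huv
      simp only [Finset.mem_coe, Finset.mem_compl]
      tauto⟩
  rw [← coe_edgeFinset, Set.ncard_coe_finset,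
    ← isBipartiteWith_sum_degrees_eq_card_edges hb]
  refine Finset.sum_congr rfl fun a _ => ?_
  rw [degN, Set.ncard_eq_toFinset_card', ← card_neighborFinset_eq_degree]
  rfl

end

/-- A minimal bipartite matching covered graph has at least `2(m - n + 2)` vertices
of degree exactly 2. -/
theorem stmt1 {V : Type*} [Fintype V] (G : SimpleGraph V)
    (hbip : G.Colorable 2) (hmin : MinimalMatchingCovered G) :
    {v | degN G v = 2}.ncard + 2 * Fintype.card V ≥ 2 * G.edgeSet.ncard + 4 := by
  classical
  obtain ⟨s, hs⟩ := exists_isColorClass hbip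
  have h1 := hmin.sum_degN_add_two_le hs
  have h2 := hmin.sum_degN_add_two_le hs.compl
  rw [hs.sum_degN] at h1
  rw [hs.compl.sum_degN] at h2
  have h3 : {v | degN G v = 2}.ncard = (s.filter fun a => degN G a = 2).card +
      (sᶜ.filter fun a => degN G a = 2).card := by
    rw [← Finset.card_union_of_disjoint
      (Finset.disjoint_filter_filter disjoint_compl_right), ← Finset.filter_union,
      Finset.union_compl, ← Set.ncard_coe_finset]
    congr 1
    ext v
    simp
  omega
end
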